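/- arXiv:2108.12796 — 5 statements merged into one kernel-verified Lean document; each statement's English description precedes it below -/
import Mathlib

section
/- (Jackson's 8φ7 summation) For complex parameters a,b,c,d,e,q with |q|<1 (or for generic parameters) and a nonnegative integer n satisfying q^{n+1} a² = b c d e, one has ∑_{k=0}^n ((1−q^{2k}a)/(1−a)) · [(a;q)_k (b;q)_k (c;q)_k (d;q)_k (e;q)_k (q^{−n};q)_k / ((q;q)_k (qa/b;q)_k (qa/c;q)_k (qa/d;q)_k (qa/e;q)_k (q^{n+1}a;q)_k)] · q^k = (qa;q)_n (qa/(bc);q)_n (qa/(bd);q)_n (qa/(cd);q)_n / ((qa/b;q)_n (qa/c;q)_n (qa/d;q)_n (qa/(bcd);q)_n). -/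
open Finset

/-- q-shifted factorial (x;q)_n = ∏_{j=0}^{n-1} (1 - x q^j). -/
noncomputable def qPoch (x q : ℂ) (n : ℕ) : ℂ :=
  ∏ j ∈ Finset.range n, (1 - x * q ^ j)

lemma qP_zero (x q : ℂ) : qPoch x q 0 = 1 := by simp [qPoch]

lemma qP_succ (x q : ℂ) (k : ℕ) : qPoch x q (k + 1) = qPoch x q k * (1 - x * q ^ k) := by
  simp [qPoch, Finset.prod_range_succ]

lemma qP_succ_left (x q : ℂ) (k : ℕ) :
    qPoch x q (k + 1) = (1 - x) * qPoch (q * x) q k := by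
  unfold qPoch
  rw [Finset.prod_range_succ']
  rw [mul_comm]
  congr 1
  · simp
  · apply Finset.prod_congr rfl
    intro j _
    ring

lemma qP_add (x q : ℂ) (k m : ℕ) :
    qPoch x q (k + m) = qPoch x q k * qPoch (x * q ^ k) q m := by
  unfold qPoch
  rw [Finset.prod_range_add]
  congr 1
  apply Finset.prod_congr rfl
  intro j _
  ring

lemma qP_ne (x q : ℂ) {k n : ℕ} (hk : k ≤ n) (h : qPoch x q n ≠ 0) : qPoch x q k ≠ 0 := by
  obtain ⟨m, rfl⟩ := Nat.exists_eq_add_of_le hk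
  rw [qP_add] at h
  exact left_ne_zero_of_mul h

lemma qP_fac (x q : ℂ) {j n : ℕ} (hj : j < n) (h : qPoch x q n ≠ 0) : 1 - x * q ^ j ≠ 0 := by
  have := qP_ne x q (Nat.succ_le_of_lt hj) h
  rw [Nat.succ_eq_add_one, qP_succ] at this
  exact right_ne_zero_of_mul this

/-- The reflected factorial does not vanish. -/
lemma qP_refl_ne (s q : ℂ) (hq : q ≠ 0) (hs : s ≠ 0) {k n : ℕ} (hk : k ≤ n)
    (h : qPoch (q * s) q n ≠ 0) : qPoch ((q ^ n * s)⁻¹) q k ≠ 0 := by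
  unfold qPoch
  rw [Finset.prod_ne_zero_iff]
  intro j hj
  have hj' : j < n := lt_of_lt_of_le (Finset.mem_range.mp hj) hk
  have h2 := qP_fac (q * s) q (j := n - 1 - j) (by omega) h
  obtain ⟨i, rfl⟩ : ∃ i, n = j + 1 + i := Nat.exists_eq_add_of_le hj'
  have e : j + 1 + i - 1 - j = i := by omega
  rw [e] at h2
  intro h3
  apply h2
  have h4 : (q ^ (j + 1 + i) * s)⁻¹ * q ^ j = (q ^ (i + 1) * s)⁻¹ := by
    field_simp
    ring
  rw [h4, sub_eq_zero] at h3
  have h5 : q ^ (i + 1) * s = 1 := by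
    rw [← inv_inv (q ^ (i + 1) * s), ← h3, inv_one]
  rw [← h5]
  ring

lemma core1 (a b c d v x : ℂ) (ha : a ≠ 0) (hb : b ≠ 0) (hc : c ≠ 0) (hd : d ≠ 0) (hv : v ≠ 0)
    (h1 : 1 - v * a / b ≠ 0) (h2 : 1 - v * a / c ≠ 0) (h3 : 1 - v * a / d ≠ 0)
    (h4 : 1 - v * a / (b * c * d) ≠ 0) (e r : ℂ) (he : e = v * a ^ 2 / (b * c * d))
    (hr : r = (1 - v * a / (b * c)) * (1 - v * a / (b * d)) * (1 - v * a / (c * d)) /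
      ((1 - v * a / b) * (1 - v * a / c) * (1 - v * a / d) * (1 - v * a / (b * c * d)))) :
    (1 - (1 - v * a) * r) *
      ((1 - a * x) * (1 - b * x) * (1 - c * x) * (1 - d * x) * (1 - e * x) * (1 - x / v)
      - (1 - x) * (1 - a * x / b) * (1 - a * x / c) * (1 - a * x / d) * (1 - a * x / e)
        * (1 - v * x * a)) =
    (1 - a * x ^ 2) * x * (1 - b) * (1 - c) * (1 - d) *
      ((1 - e * x) * (1 - 1 / v) * (1 - a * x / e) / (1 - a / e)
        - r * (1 - e) * (1 - x / v) * (1 - v * x * a)) := by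
  have e1 : b - v * a ≠ 0 := by
    intro h; apply h1; field_simp; rw [mul_zero]; exact h
  have e2 : c - v * a ≠ 0 := by
    intro h; apply h2; field_simp; rw [mul_zero]; exact h
  have e3 : d - v * a ≠ 0 := by
    intro h; apply h3; field_simp; rw [mul_zero]; exact h
  have e4 : b * c * d - v * a ≠ 0 := by
    intro h; apply h4; field_simp; rw [mul_zero]; exact h
  have hr' : r = ((b * c - v * a) * (b * d - v * a) * (c * d - v * a)) /
      ((b - v * a) * (c - v * a) * (d - v * a) * (b * c * d - v * a)) * 1 := by
    rw [hr]; field_simp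
  have hmain : (1 - (1 - v * a) * r) = -((1 - b) * (1 - c) * (1 - d) * (v * a) *
      (b * c * d - (v * a) ^ 2)) / 
      ((b - v * a) * (c - v * a) * (d - v * a) * (b * c * d - v * a)) := by
    rw [hr']; field_simp; ring
  have hae : a / e = b * c * d / (v * a) := by rw [he]; field_simp
  have haxe : a * x / e = b * c * d * x / (v * a) := by rw [he]; field_simp
  have e5 : 1 - a / e = -(b * c * d - v * a) / (v * a) := by rw [hae]; field_simp; ring
  rw [hmain, e5, haxe, hr', he]
  field_simp
  ring

lemma core2 (a b c d v : ℂ) (ha : a ≠ 0) (hb : b ≠ 0) (hc : c ≠ 0) (hd : d ≠ 0) (hv : v ≠ 0)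
    (h1 : 1 - v * a / b ≠ 0) (h2 : 1 - v * a / c ≠ 0) (h3 : 1 - v * a / d ≠ 0)
    (h4 : 1 - v * a / (b * c * d) ≠ 0) (e r : ℂ) (he : e = v * a ^ 2 / (b * c * d))
    (hr : r = (1 - v * a / (b * c)) * (1 - v * a / (b * d)) * (1 - v * a / (c * d)) /
      ((1 - v * a / b) * (1 - v * a / c) * (1 - v * a / d) * (1 - v * a / (b * c * d)))) :
    (1 - (1 - v * a) * r) *
      (- ((1 - v) * (1 - a * v / b) * (1 - a * v / c) * (1 - a * v / d)
        * (1 - v * v * a))) =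
    (1 - a * v ^ 2) * v * (1 - b) * (1 - c) * (1 - d) *
      ((1 - e * v) * (1 - 1 / v) / (1 - a / e)) := by
  have e1 : b - v * a ≠ 0 := by
    intro h; apply h1; field_simp; rw [mul_zero]; exact h
  have e2 : c - v * a ≠ 0 := by
    intro h; apply h2; field_simp; rw [mul_zero]; exact h
  have e3 : d - v * a ≠ 0 := by
    intro h; apply h3; field_simp; rw [mul_zero]; exact h
  have e4 : b * c * d - v * a ≠ 0 := by
    intro h; apply h4; field_simp; rw [mul_zero]; exact h
  have hmain : (1 - (1 - v * a) * r) = -((1 - b) * (1 - c) * (1 - d) * (v * a) *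
      (b * c * d - (v * a) ^ 2)) / 
      ((b - v * a) * (c - v * a) * (d - v * a) * (b * c * d - v * a)) := by
    rw [hr]; field_simp; ring
  have hae : a / e = b * c * d / (v * a) := by rw [he]; field_simp
  have e5 : 1 - a / e = -(b * c * d - v * a) / (v * a) := by rw [hae]; field_simp; ring
  rw [hmain, e5, he]
  field_simp
  ring

lemma alg1 (g α β γ δ ε μ E1 E2 E3 E4 η ω A1 A2 A3 A4 A5 A6 f1 f2 f3 f4 f5 f6 s a1 b1 c1 d1 e1 m h x
    r : ℂ) (hE1 : E1 ≠ 0) (hE2 : E2 ≠ 0) (hE3 : E3 ≠ 0) (hE4 : E4 ≠ 0) (hη : η ≠ 0)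
    (hf1 : f1 ≠ 0) (hf2 : f2 ≠ 0) (hf3 : f3 ≠ 0) (hf4 : f4 ≠ 0) (hf5 : f5 ≠ 0) (hh : h ≠ 0)
    (ha1 : a1 ≠ 0)
    (core : g * (A1 * A2 * A3 * A4 * A5 * A6 - f1 * f2 * f3 * f4 * f5 * f6) =
      s * x * b1 * c1 * d1 * (A5 * m * f5 / h - r * e1 * A6 * f6)) :
    g * ((α * f6 * ω * β * γ * δ * ε * μ) / (E1 * E2 * E3 * E4 * η)) +
      (s / a1 * ((a1 * α) * (b1 * β) * (c1 * γ) * (d1 * δ) * (ε * A5) * (m * μ) /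
        ((E1 * f1) * (E2 * f2) * (E3 * f3) * (E4 * f4) * (h * η))) * x * ω
      - r * (s / a1 * ((a1 * α) * (b1 * β) * (c1 * γ) * (d1 * δ) * (e1 * ε) * (μ * A6) /
        ((E1 * f1) * (E2 * f2) * (E3 * f3) * (E4 * f4) * (η * f5))) * x * (f6 * ω))) =
    g * (((α * A1) * ω * (β * A2) * (γ * A3) * (δ * A4) * (ε * A5) * (μ * A6)) /
      ((E1 * f1) * (E2 * f2) * (E3 * f3) * (E4 * f4) * (η * f5))) := by
  have core' : h * g * (A1 * A2 * A3 * A4 * A5 * A6 - f1 * f2 * f3 * f4 * f5 * f6) =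
      s * x * b1 * c1 * d1 * (A5 * m * f5 - h * (r * e1 * A6 * f6)) := by
    rw [mul_assoc, core]; field_simp
  field_simp
  linear_combination (-(α * ω * β * γ * δ * ε * μ)) * core'

lemma alg2 (g α β γ δ ε μ E1 E2 E3 E4 η A5 f1 f2 f3 f4 f6 s a1 b1 c1 d1 m h x
    : ℂ) (hE1 : E1 ≠ 0) (hE2 : E2 ≠ 0) (hE3 : E3 ≠ 0) (hE4 : E4 ≠ 0) (hη : η ≠ 0)
    (hf1 : f1 ≠ 0) (hf2 : f2 ≠ 0) (hf3 : f3 ≠ 0) (hf4 : f4 ≠ 0) (hh : h ≠ 0)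
    (ha1 : a1 ≠ 0)
    (core : g * (- (f1 * f2 * f3 * f4 * f6)) =
      s * x * b1 * c1 * d1 * (A5 * m / h)) :
    g * ((α * f6 * β * γ * δ * ε * μ) / (E1 * E2 * E3 * E4 * η)) +
      (s / a1 * ((a1 * α) * (b1 * β) * (c1 * γ) * (d1 * δ) * (ε * A5) * (m * μ) /
        ((E1 * f1) * (E2 * f2) * (E3 * f3) * (E4 * f4) * (h * η))) * x) = 0 := by
  have core' : h * g * (- (f1 * f2 * f3 * f4 * f6)) =
      s * x * b1 * c1 * d1 * (A5 * m) := by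
    rw [mul_assoc, core]; field_simp
  field_simp
  linear_combination (-(α * β * γ * δ * ε * μ)) * core'

/-- The summand without the factor `1 / (q^(n+1) a; q)_k`. -/
noncomputable def JV (a b c d q : ℂ) (e t : ℂ) (k : ℕ) : ℂ :=
  ((1 - q ^ (2 * k) * a) / (1 - a)) *
    (qPoch a q k * qPoch b q k * qPoch c q k * qPoch d q k * qPoch e q k * qPoch t q k /
      (qPoch q q k * qPoch (q * a / b) q k * qPoch (q * a / c) q k *
            qPoch (q * a / d) q k * qPoch (q * a / e) q k)) * q ^ k

noncomputable def JG (a b c d q : ℂ) (e t w : ℂ) (k : ℕ) : ℂ :=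
  (qPoch (q * a) q k * w * qPoch (q * b) q k * qPoch (q * c) q k * qPoch (q * d) q k *
    qPoch (q * e) q k * qPoch t q k /
      (qPoch q q k * qPoch (q * a / b) q k * qPoch (q * a / c) q k *
            qPoch (q * a / d) q k * qPoch (q * a / e) q k))

lemma JV_hi (a b c d q e v : ℂ) (hq : q ≠ 0) (k : ℕ) :
    JV a b c d q (q * e) v⁻¹ (k + 1) =
    (1 - a * (q ^ (k + 1)) ^ 2) / (1 - a) * (((1 - a) * qPoch (q * a) q k) *
      ((1 - b) * qPoch (q * b) q k) * ((1 - c) * qPoch (q * c) q k) *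
      ((1 - d) * qPoch (q * d) q k) * (qPoch (q * e) q k * (1 - e * q ^ (k + 1))) *
      ((1 - 1 / v) * qPoch (q / v) q k) /
      ((qPoch q q k * (1 - q ^ (k + 1))) *
        (qPoch (q * a / b) q k * (1 - a * q ^ (k + 1) / b)) *
        (qPoch (q * a / c) q k * (1 - a * q ^ (k + 1) / c)) *
        (qPoch (q * a / d) q k * (1 - a * q ^ (k + 1) / d)) *
        ((1 - a / e) * qPoch (q * a / e) q k))) * q ^ (k + 1) := by
  unfold JV
  have h : q * a / (q * e) = a / e := by field_simp
  rw [h, qP_succ_left a, qP_succ_left b, qP_succ_left c, qP_succ_left d, qP_succ_left v⁻¹,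
    qP_succ_left (a / e), qP_succ q, qP_succ (q * e), qP_succ (q * a / b), qP_succ (q * a / c),
    qP_succ (q * a / d)]
  have e1 : q * e * q ^ k = e * q ^ (k + 1) := by ring
  have e2 : ∀ y, q * a / y * q ^ k = a * q ^ (k + 1) / y := by intro y; ring
  have e3 : q * q ^ k = q ^ (k + 1) := by ring
  have e4 : q * v⁻¹ = q / v := by ring
  have e5 : v⁻¹ = 1 / v := by ring
  have e6 : q * (a / e) = q * a / e := by ring
  have e7 : q ^ (2 * (k + 1)) * a = a * (q ^ (k + 1)) ^ 2 := by ring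
  rw [e1, e2, e2, e2, e3, e4, e5, e6, e7]

lemma JV_lo (a b c d q e v : ℂ) (k : ℕ) :
    JV a b c d q e (q / v) (k + 1) =
    (1 - a * (q ^ (k + 1)) ^ 2) / (1 - a) * (((1 - a) * qPoch (q * a) q k) *
      ((1 - b) * qPoch (q * b) q k) * ((1 - c) * qPoch (q * c) q k) *
      ((1 - d) * qPoch (q * d) q k) * ((1 - e) * qPoch (q * e) q k) *
      (qPoch (q / v) q k * (1 - q ^ (k + 1) / v)) /
      ((qPoch q q k * (1 - q ^ (k + 1))) *
        (qPoch (q * a / b) q k * (1 - a * q ^ (k + 1) / b)) *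
        (qPoch (q * a / c) q k * (1 - a * q ^ (k + 1) / c)) *
        (qPoch (q * a / d) q k * (1 - a * q ^ (k + 1) / d)) *
        (qPoch (q * a / e) q k * (1 - a * q ^ (k + 1) / e)))) * q ^ (k + 1) := by
  unfold JV
  rw [qP_succ_left a, qP_succ_left b, qP_succ_left c, qP_succ_left d, qP_succ_left e,
    qP_succ (q / v), qP_succ (q * a / e),
    qP_succ q, qP_succ (q * a / b), qP_succ (q * a / c),
    qP_succ (q * a / d)]
  have e2 : ∀ y, q * a / y * q ^ k = a * q ^ (k + 1) / y := by intro y; ring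
  have e3 : q * q ^ k = q ^ (k + 1) := by ring
  have e4 : q / v * q ^ k = q ^ (k + 1) / v := by ring
  have e7 : q ^ (2 * (k + 1)) * a = a * (q ^ (k + 1)) ^ 2 := by ring
  rw [e2, e2, e2, e2, e3, e4, e7]

lemma JG_succ (a b c d q e v w : ℂ) (k : ℕ) :
    JG a b c d q e (q / v) w (k + 1) =
    ((qPoch (q * a) q k * (1 - a * q ^ (k + 1))) * w *
      (qPoch (q * b) q k * (1 - b * q ^ (k + 1))) * (qPoch (q * c) q k * (1 - c * q ^ (k + 1))) *
      (qPoch (q * d) q k * (1 - d * q ^ (k + 1))) * (qPoch (q * e) q k * (1 - e * q ^ (k + 1))) *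
      (qPoch (q / v) q k * (1 - q ^ (k + 1) / v))) /
      ((qPoch q q k * (1 - q ^ (k + 1))) *
        (qPoch (q * a / b) q k * (1 - a * q ^ (k + 1) / b)) *
        (qPoch (q * a / c) q k * (1 - a * q ^ (k + 1) / c)) *
        (qPoch (q * a / d) q k * (1 - a * q ^ (k + 1) / d)) *
        (qPoch (q * a / e) q k * (1 - a * q ^ (k + 1) / e))) := by
  unfold JG
  have e2 : ∀ y, q * a / y * q ^ k = a * q ^ (k + 1) / y := by intro y; ring
  have e3 : q * q ^ k = q ^ (k + 1) := by ring
  have e4 : q / v * q ^ k = q ^ (k + 1) / v := by ring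
  have e5 : ∀ y, q * y * q ^ k = y * q ^ (k + 1) := by intro y; ring
  rw [qP_succ (q * a), qP_succ (q * b), qP_succ (q * c), qP_succ (q * d), qP_succ (q * e),
    qP_succ (q / v), qP_succ (q * a / e),
    qP_succ q, qP_succ (q * a / b), qP_succ (q * a / c),
    qP_succ (q * a / d), e2, e2, e2, e2, e3, e4, e5, e5, e5, e5, e5]

/-- weights -/
lemma w_step (a q : ℂ) (n k : ℕ) (hk : k ≤ n) :
    qPoch (q ^ (n + 2 + k) * a) q (n + 1 - k) =
      (1 - q ^ (n + 1) * q ^ (k + 1) * a) * qPoch (q ^ (n + 2 + (k + 1)) * a) q (n + 1 - (k + 1)) := by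
  have : n + 1 - k = (n + 1 - (k + 1)) + 1 := by omega
  rw [this, qP_succ_left]
  have e1 : q * (q ^ (n + 2 + k) * a) = q ^ (n + 2 + (k + 1)) * a := by ring
  have e2 : q ^ (n + 2 + k) * a = q ^ (n + 1) * q ^ (k + 1) * a := by ring
  rw [e1, e2]

lemma w_two (a q : ℂ) (n k : ℕ) (hk : k ≤ n) :
    qPoch (q ^ (n + 1 + k) * a) q (n + 2 - k) =
      qPoch (q ^ (n + 1 + k) * a) q (n - k) *
        ((1 - a * q ^ (2 * n + 1)) * (1 - a * q ^ (2 * n + 2))) := by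
  obtain ⟨m, rfl⟩ := Nat.exists_eq_add_of_le hk
  have e1 : k + m + 2 - k = m + 1 + 1 := by omega
  have e2 : k + m - k = m := by omega
  rw [e1, e2, qP_succ, qP_succ]
  ring

section
variable (a b c d q : ℂ) (n : ℕ)

lemma jackson_step (hq : q ≠ 0) (ha0 : a ≠ 0) (ha : 1 - a ≠ 0)
    (hb : b ≠ 0) (hc : c ≠ 0) (hd : d ≠ 0)
    (h1 : qPoch q q (n + 1) ≠ 0)
    (h2 : qPoch (q * a / b) q (n + 1) ≠ 0)
    (h3 : qPoch (q * a / c) q (n + 1) ≠ 0)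
    (h4 : qPoch (q * a / d) q (n + 1) ≠ 0)
    (h7 : qPoch (q * a / (b * c * d)) q (n + 1) ≠ 0)
    (v e r : ℂ) (hv : v = q ^ (n + 1)) (he : e = v * a ^ 2 / (b * c * d))
    (hr : r = (1 - v * a / (b * c)) * (1 - v * a / (b * d)) * (1 - v * a / (c * d)) /
      ((1 - v * a / b) * (1 - v * a / c) * (1 - v * a / d) * (1 - v * a / (b * c * d)))) :
    ∑ k ∈ range (n + 1), (JV a b c d q (q * e) v⁻¹ k * qPoch (q ^ (n + 2 + k) * a) q (n + 1 - k) -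
      r * (JV a b c d q e (q / v) k * qPoch (q ^ (n + 1 + k) * a) q (n + 2 - k))) +
      JV a b c d q (q * e) v⁻¹ (n + 1) = 0 := by
  have hv0 : v ≠ 0 := by rw [hv]; exact pow_ne_zero _ hq
  have he0 : e ≠ 0 := by rw [he]; positivity
  have fac : ∀ y, qPoch (q * a / y) q (n + 1) ≠ 0 → ∀ k ≤ n, 1 - a * q ^ (k + 1) / y ≠ 0 := by
    intro y hy k hk
    have := qP_fac _ _ (Nat.lt_succ_of_le hk) hy
    have e2 : q * a / y * q ^ k = a * q ^ (k + 1) / y := by ring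
    rwa [e2] at this
  have fac' : ∀ y, qPoch (q * a / y) q (n + 1) ≠ 0 → 1 - v * a / y ≠ 0 := by
    intro y hy
    have := fac y hy n le_rfl
    rwa [← hv, mul_comm a v] at this
  have fac1 : ∀ k ≤ n, 1 - q ^ (k + 1) ≠ 0 := by
    intro k hk
    have := qP_fac _ _ (Nat.lt_succ_of_le hk) h1
    have e2 : q * q ^ k = q ^ (k + 1) := by ring
    rwa [e2] at this
  have hη : ∀ k ≤ n, qPoch (q * a / e) q k ≠ 0 := by
    intro k hk
    have h := qP_refl_ne (a / (b * c * d)) q hq (by positivity) hk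
      (by rw [← mul_div_assoc]; exact qP_ne _ _ (Nat.le_succ n) h7)
    have e1 : (q ^ n * (a / (b * c * d)))⁻¹ = q * a / e := by
      rw [he, hv]; field_simp; try ring
    rwa [e1] at h
  have hh : 1 - a / e ≠ 0 := by
    have h8 := fac' _ h7
    intro h
    apply h8
    have h9 : a / e * (v * a / (b * c * d)) = 1 := by rw [he]; field_simp
    have h10 : a / e = 1 := (sub_eq_zero.mp h).symm
    rw [h10, one_mul] at h9
    rw [h9, sub_self]
  have key : ∀ K ≤ n, ∑ k ∈ range (K + 1),
      (JV a b c d q (q * e) v⁻¹ k * qPoch (q ^ (n + 2 + k) * a) q (n + 1 - k) -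
      r * (JV a b c d q e (q / v) k * qPoch (q ^ (n + 1 + k) * a) q (n + 2 - k))) =
      (1 - (1 - v * a) * r) *
        JG a b c d q e (q / v) (qPoch (q ^ (n + 2 + K) * a) q (n + 1 - K)) K := by
    intro K
    induction K with
    | zero =>
      intro _
      have e1 : n + 2 - 0 = n + 1 + 1 := by omega
      have e2 : q * (q ^ (n + 1 + 0) * a) = q ^ (n + 2 + 0) * a := by ring
      have e3 : q ^ (n + 1 + 0) * a = v * a := by rw [hv, Nat.add_zero]
      rw [Finset.sum_range_one, e1, qP_succ_left, e2, e3]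
      simp only [JV, JG, qP_zero]
      have : (1 - q ^ (2 * 0) * a) / (1 - a) = 1 := by simp [ha]
      rw [this]
      simp only [Nat.sub_zero, pow_zero]
      ring
    | succ K ih =>
      intro hK
      rw [Finset.sum_range_succ, ih (by omega), JV_hi _ _ _ _ _ _ _ hq, JV_lo, JG_succ]
      have e1 : n + 2 - (K + 1) = n + 1 - K := by omega
      have e2 : n + 1 + (K + 1) = n + 2 + K := by omega
      rw [e1, e2, w_step a q n K (by omega), ← hv]
      have core := core1 a b c d v (q ^ (K + 1)) ha0 hb hc hd hv0 (fac' b h2) (fac' c h3)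
        (fac' d h4) (fac' _ h7) e r he hr
      have hf5 : 1 - a * q ^ (K + 1) / e ≠ 0 := by
        have := hη (K + 1) hK
        rw [qP_succ] at this
        have e2 : q * a / e * q ^ K = a * q ^ (K + 1) / e := by ring
        rw [e2] at this
        exact right_ne_zero_of_mul this
      have := alg1 _ (qPoch (q * a) q K) (qPoch (q * b) q K) (qPoch (q * c) q K)
        (qPoch (q * d) q K) (qPoch (q * e) q K) (qPoch (q / v) q K) (qPoch q q K)
        (qPoch (q * a / b) q K) (qPoch (q * a / c) q K) (qPoch (q * a / d) q K)
        (qPoch (q * a / e) q K) (qPoch (q ^ (n + 2 + (K + 1)) * a) q (n + 1 - (K + 1)))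
        _ _ _ _ _ _ _ _ _ _ _ _ _ (1 - a) _ _ _ _ _ _ _ _
        (qP_ne _ _ (by omega) h1) (qP_ne _ _ (by omega) h2) (qP_ne _ _ (by omega) h3)
        (qP_ne _ _ (by omega) h4) (hη K (by omega)) (fac1 K (by omega)) (fac b h2 K (by omega))
        (fac c h3 K (by omega)) (fac d h4 K (by omega)) hf5 hh ha core
      rw [← this]
      unfold JG
      ring
  rw [key n le_rfl, JV_hi _ _ _ _ _ _ _ hq, w_step a q n n le_rfl, ← hv]
  have core := core2 a b c d v ha0 hb hc hd hv0 (fac' b h2) (fac' c h3)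
        (fac' d h4) (fac' _ h7) e r he hr
  have fb := fac b h2 n le_rfl
  have fc := fac c h3 n le_rfl
  have fd := fac d h4 n le_rfl
  have f1 := fac1 n le_rfl
  rw [← hv] at fb fc fd f1
  have := alg2 _ (qPoch (q * a) q n) (qPoch (q * b) q n) (qPoch (q * c) q n)
        (qPoch (q * d) q n) (qPoch (q * e) q n) (qPoch (q / v) q n) (qPoch q q n)
        (qPoch (q * a / b) q n) (qPoch (q * a / c) q n) (qPoch (q * a / d) q n)
        (qPoch (q * a / e) q n)
        _ _ _ _ _ _ _ (1 - a) _ _ _ _ _ _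
        (qP_ne _ _ (by omega) h1) (qP_ne _ _ (by omega) h2) (qP_ne _ _ (by omega) h3)
        (qP_ne _ _ (by omega) h4) (hη n (by omega)) f1 fb fc fd hh ha core
  rw [← this]
  unfold JG
  rw [Nat.sub_self, qP_zero]
  ring

lemma cleared (hq : q ≠ 0) (ha0 : a ≠ 0) (ha : 1 - a ≠ 0)
    (hb : b ≠ 0) (hc : c ≠ 0) (hd : d ≠ 0)
    (h1 : qPoch q q n ≠ 0)
    (h2 : qPoch (q * a / b) q n ≠ 0)
    (h3 : qPoch (q * a / c) q n ≠ 0)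
    (h4 : qPoch (q * a / d) q n ≠ 0)
    (h7 : qPoch (q * a / (b * c * d)) q n ≠ 0) :
    ∑ k ∈ range (n + 1), JV a b c d q (q ^ (n + 1) * a ^ 2 / (b * c * d)) (q ^ n)⁻¹ k *
      qPoch (q ^ (n + 1 + k) * a) q (n - k) =
    qPoch (q * a) q (2 * n) * (qPoch (q * a / (b * c)) q n * qPoch (q * a / (b * d)) q n *
        qPoch (q * a / (c * d)) q n /
      (qPoch (q * a / b) q n * qPoch (q * a / c) q n * qPoch (q * a / d) q n *
        qPoch (q * a / (b * c * d)) q n)) := by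
  induction n with
  | zero => simp [JV, qPoch, ha]
  | succ n ih =>
    have ih := ih (qP_ne _ _ (by omega) h1) (qP_ne _ _ (by omega) h2) (qP_ne _ _ (by omega) h3)
      (qP_ne _ _ (by omega) h4) (qP_ne _ _ (by omega) h7)
    have ps := jackson_step a b c d q n hq ha0 ha hb hc hd h1 h2 h3 h4 h7 _ _ _ rfl rfl rfl
    rw [Finset.sum_sub_distrib, ← Finset.mul_sum] at ps
    have eq1 : q / q ^ (n + 1) = (q ^ n)⁻¹ := by
      field_simp
      ring
    have eq2 : q * (q ^ (n + 1) * a ^ 2 / (b * c * d)) =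
      q ^ (n + 1 + 1) * a ^ 2 / (b * c * d) := by ring
    rw [eq1, eq2] at ps
    have s2 : ∑ k ∈ range (n + 1), JV a b c d q (q ^ (n + 1) * a ^ 2 / (b * c * d)) (q ^ n)⁻¹ k *
        qPoch (q ^ (n + 1 + k) * a) q (n + 2 - k) =
        (∑ k ∈ range (n + 1), JV a b c d q (q ^ (n + 1) * a ^ 2 / (b * c * d)) (q ^ n)⁻¹ k *
          qPoch (q ^ (n + 1 + k) * a) q (n - k)) *
        ((1 - a * q ^ (2 * n + 1)) * (1 - a * q ^ (2 * n + 2))) := by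
      rw [Finset.sum_mul]
      apply Finset.sum_congr rfl
      intro k hk
      rw [w_two a q n k (by have := Finset.mem_range.mp hk; omega)]
      ring
    rw [s2, ih] at ps
    rw [Finset.sum_range_succ, Nat.sub_self, qP_zero, mul_one]
    have e3 : 2 * (n + 1) = 2 * n + 1 + 1 := by ring
    have e4 : ∀ y, q * a / y * q ^ n = q ^ (n + 1) * a / y := by intro y; ring
    have e5 : q * a * q ^ (2 * n) = a * q ^ (2 * n + 1) := by ring
    have e6 : q * a * q ^ (2 * n + 1) = a * q ^ (2 * n + 2) := by ring
    rw [e3]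
    simp only [qP_succ _ _ n, qP_succ _ _ (2 * n), qP_succ _ _ (2 * n + 1), e4, e5, e6]
    have e7 : n + 2 = n + 1 + 1 := rfl
    rw [e7] at ps
    rw [← sub_eq_zero, ← ps]
    simp only [div_eq_mul_inv, mul_inv]
    ring
end

theorem jackson_8phi7 (a b c d e q : ℂ) (n : ℕ)
    (hq : q ≠ 0) (hbal : q ^ (n + 1) * a ^ 2 = b * c * d * e)
    (ha : (1 : ℂ) - a ≠ 0)
    (h1 : ∀ k : ℕ, k ≤ n → qPoch q q k ≠ 0)
    (h2 : ∀ k : ℕ, k ≤ n → qPoch (q * a / b) q k ≠ 0)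
    (h3 : ∀ k : ℕ, k ≤ n → qPoch (q * a / c) q k ≠ 0)
    (h4 : ∀ k : ℕ, k ≤ n → qPoch (q * a / d) q k ≠ 0)
    (h5 : ∀ k : ℕ, k ≤ n → qPoch (q * a / e) q k ≠ 0)
    (h6 : ∀ k : ℕ, k ≤ n → qPoch (q ^ (n + 1) * a) q k ≠ 0)
    (h7 : qPoch (q * a / (b * c * d)) q n ≠ 0)
    (hb : b ≠ 0) (hc : c ≠ 0) (hd : d ≠ 0) (he : e ≠ 0) :
    ∑ k ∈ Finset.range (n + 1),
      ((1 - q ^ (2 * k) * a) / (1 - a)) *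
        (qPoch a q k * qPoch b q k * qPoch c q k * qPoch d q k * qPoch e q k *
            qPoch (q ^ (-(n : ℤ))) q k /
          (qPoch q q k * qPoch (q * a / b) q k * qPoch (q * a / c) q k *
            qPoch (q * a / d) q k * qPoch (q * a / e) q k *
            qPoch (q ^ (n + 1) * a) q k)) * q ^ k
      =
    qPoch (q * a) q n * qPoch (q * a / (b * c)) q n * qPoch (q * a / (b * d)) q n *
        qPoch (q * a / (c * d)) q n /
      (qPoch (q * a / b) q n * qPoch (q * a / c) q n * qPoch (q * a / d) q n *
        qPoch (q * a / (b * c * d)) q n) := by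
  have ha0 : a ≠ 0 := by
    rintro rfl
    have : b * c * d * e ≠ 0 := by positivity
    apply this
    rw [← hbal]; ring
  have he' : q ^ (n + 1) * a ^ 2 / (b * c * d) = e := by
    rw [hbal]; field_simp
  have main := cleared a b c d q n hq ha0 ha hb hc hd (h1 n le_rfl) (h2 n le_rfl) (h3 n le_rfl)
    (h4 n le_rfl) h7
  rw [he'] at main
  have hz : q ^ (-(n : ℤ)) = (q ^ n)⁻¹ := by rw [zpow_neg, zpow_natCast]
  have hP := h6 n le_rfl
  rw [hz]
  apply mul_right_cancel₀ hP
  have hs : qPoch (q * a) q (2 * n) = qPoch (q * a) q n * qPoch (q ^ (n + 1) * a) q n := by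
    rw [two_mul, qP_add]
    congr 2
    ring
  rw [hs] at main
  have e1 : ∀ A B C D E : ℂ, A * B * C * D / E * qPoch (q ^ (n + 1) * a) q n =
      A * qPoch (q ^ (n + 1) * a) q n * (B * C * D / E) := by intros; ring
  rw [e1, ← main, Finset.sum_mul]
  apply Finset.sum_congr rfl
  intro k hk
  have hkn : k ≤ n := by have := Finset.mem_range.mp hk; omega
  have hsp : qPoch (q ^ (n + 1) * a) q n =
      qPoch (q ^ (n + 1) * a) q k * qPoch (q ^ (n + 1 + k) * a) q (n - k) := by
    conv_lhs => rw [← Nat.add_sub_cancel' hkn, qP_add]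
    have : n + 1 + k = n + 1 + k := rfl
    rw [Nat.add_sub_cancel' hkn]
    congr 2
    ring
  rw [hsp]
  have hk6 := h6 k hkn
  unfold JV
  generalize qPoch (q ^ (n + 1) * a) q k = P at hk6 ⊢
  simp only [div_eq_mul_inv, mul_inv]
  have := mul_inv_cancel₀ hk6
  linear_combination (((1 - q ^ (2 * k) * a) * (1 - a)⁻¹) *
    (qPoch a q k * qPoch b q k * qPoch c q k * qPoch d q k * qPoch e q k *
      qPoch (q ^ n)⁻¹ q k * ((qPoch q q k)⁻¹ * (qPoch (q * a * b⁻¹) q k)⁻¹ *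
      (qPoch (q * a * c⁻¹) q k)⁻¹ * (qPoch (q * a * d⁻¹) q k)⁻¹ *
      (qPoch (q * a * e⁻¹) q k)⁻¹)) * q ^ k * qPoch (q ^ (n + 1 + k) * a) q (n - k)) * this
end

section
/- (Guillera's series for 1/π²) 32/π² = ∑_{n=0}^∞ (1/16^n) · [(1/2)_n³ (1/4)_n (3/4)_n / (n!)⁵] · (3 + 34n + 120n²). -/
open Real

/-- Pochhammer symbol (x)_n = x (x+1) ⋯ (x+n-1). -/
noncomputable def poch (x : ℝ) (n : ℕ) : ℝ :=
  ∏ k ∈ Finset.range n, (x + k)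

open Filter Topology

/-- Hypergeometric part of the WZ term. -/
noncomputable def gT (k : ℝ) : ℕ → ℝ
  | 0 => 1
  | n + 1 => gT k n * (((n : ℝ) + 1/2) ^ 3 * (1/2 - k + 2 * n) * (3/2 - k + 2 * n) /
      (64 * ((n : ℝ) + 1) ^ 3 * (1 + k + n) ^ 2))

noncomputable def gQ (k : ℝ) (n : ℕ) : ℝ :=
  120 * (n : ℝ) ^ 2 + 84 * k * n + 34 * n + 10 * k + 3

noncomputable def gS (k : ℝ) : ℝ := ∑' n : ℕ, gT k n * gQ k n

lemma gT_bound (k : ℝ) (hk : 0 ≤ k) (n : ℕ) : |gT k n| ≤ (1/16 : ℝ) ^ n := by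
  induction n with
  | zero => simp [gT]
  | succ n ih =>
    have hn : (0 : ℝ) ≤ n := Nat.cast_nonneg n
    rw [gT, abs_mul, pow_succ]
    apply mul_le_mul ih _ (abs_nonneg _) (by positivity)
    rw [abs_div, abs_mul, abs_mul]
    have h1 : |((n : ℝ) + 1/2) ^ 3| ≤ ((n : ℝ) + 1) ^ 3 := by
      rw [abs_of_nonneg (by positivity)]
      gcongr
      norm_num
    have h2 : |1/2 - k + 2 * (n : ℝ)| ≤ 2 * (1 + k + n) := by
      rw [abs_le]; constructor <;> linarith
    have h3 : |3/2 - k + 2 * (n : ℝ)| ≤ 2 * (1 + k + n) := by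
      rw [abs_le]; constructor <;> linarith
    have hp : (0 : ℝ) < 64 * ((n : ℝ) + 1) ^ 3 * (1 + k + n) ^ 2 := by positivity
    rw [abs_of_pos hp, div_le_iff₀ hp]
    calc _ ≤ ((n : ℝ) + 1) ^ 3 * (2 * (1 + k + n)) * (2 * (1 + k + n)) :=
        mul_le_mul (mul_le_mul h1 h2 (abs_nonneg _) (by positivity)) h3 (abs_nonneg _) (by positivity)
      _ = _ := by ring

lemma gPow (m : ℕ) : Summable (fun n : ℕ => ((n : ℝ) + 1) ^ m * (1/16 : ℝ) ^ n) := by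
  have h := summable_pow_mul_geometric_of_norm_lt_one (R := ℝ) m (r := 1/16) (by norm_num)
  have h2 := ((summable_nat_add_iff 1).2 h).mul_left 16
  refine h2.congr fun n => ?_
  push_cast
  rw [pow_succ (1/16 : ℝ)]
  ring

lemma gTQ_bound (k : ℝ) (hk : 0 ≤ k) (n : ℕ) :
    |gT k n * gQ k n| ≤ (251 * (k + 1)) * (((n : ℝ) + 1) ^ 2 * (1/16 : ℝ) ^ n) := by
  have hn : (0 : ℝ) ≤ n := Nat.cast_nonneg n
  rw [abs_mul]
  have hq : |gQ k n| ≤ 251 * (k + 1) * ((n : ℝ) + 1) ^ 2 := by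
    have : 0 ≤ gQ k n := by unfold gQ; positivity
    rw [abs_of_nonneg this]
    unfold gQ
    have := mul_nonneg hk hn
    have := mul_nonneg this hn
    nlinarith
  calc _ ≤ (1/16 : ℝ) ^ n * (251 * (k + 1) * ((n : ℝ) + 1) ^ 2) := by
        gcongr
        exact gT_bound k hk n
    _ = _ := by ring

lemma gSummable (k : ℝ) (hk : 0 ≤ k) : Summable (fun n => gT k n * gQ k n) :=
  Summable.of_norm_bounded ((gPow 2).mul_left _) (fun n => gTQ_bound k hk n)

lemma gT_shift (k : ℝ) (hk : 0 ≤ k) (n : ℕ) :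
    gT k n * ((k + 1/2) * (k + 1) ^ 2) =
      gT (k + 1) n * ((k + 1/2 - 2 * n) * (k + 1 + n) ^ 2) := by
  induction n with
  | zero => simp [gT]
  | succ n ih =>
    have hn : (0 : ℝ) ≤ n := Nat.cast_nonneg n
    have e1 : (1 + k + n : ℝ) ≠ 0 := by positivity
    have e2 : (1 + (k + 1) + n : ℝ) ≠ 0 := by positivity
    have e3 : (n + 1 : ℝ) ≠ 0 := by positivity
    rw [gT, gT, mul_right_comm, ih]
    push_cast
    field_simp
    ring

/-- WZ mate. -/
noncomputable def gV (k : ℝ) (n : ℕ) : ℝ :=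
  gT (k + 1) n * (-256 * (n : ℝ) ^ 3 * (1 + k + n) ^ 2)

lemma gWZ (k : ℝ) (hk : 0 ≤ k) (n : ℕ) :
    (k + 1/2) ^ 3 * (gT (k + 1) n * gQ (k + 1) n) -
      ((k + 1/2) * (k + 1) ^ 2) * (gT k n * gQ k n) = gV k (n + 1) - gV k n := by
  have hn : (0 : ℝ) ≤ n := Nat.cast_nonneg n
  have e2 : (1 + (k + 1) + n : ℝ) ≠ 0 := by positivity
  have e3 : (n + 1 : ℝ) ≠ 0 := by positivity
  have h := gT_shift k hk n
  have : ((k + 1/2) * (k + 1) ^ 2) * (gT k n * gQ k n) =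
      gT (k + 1) n * ((k + 1/2 - 2 * n) * (k + 1 + n) ^ 2) * gQ k n := by
    rw [← h]; ring
  rw [this]
  unfold gV gQ
  rw [gT]
  push_cast
  field_simp
  ring

lemma gV_tendsto (k : ℝ) (hk : 0 ≤ k) : Tendsto (gV k) atTop (𝓝 0) := by
  have h := ((gPow 5).mul_left (256 * (k + 1) ^ 2)).tendsto_atTop_zero
  refine squeeze_zero_norm (fun n => ?_) h
  have hn : (0 : ℝ) ≤ n := Nat.cast_nonneg n
  rw [gV, Real.norm_eq_abs, abs_mul]
  have h2 : |(-256 * (n : ℝ) ^ 3 * (1 + k + n) ^ 2)| ≤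
      256 * ((n : ℝ) + 1) ^ 3 * ((k + 1) * (n + 1)) ^ 2 := by
    rw [abs_mul, abs_mul, abs_of_nonneg (by positivity : (0 : ℝ) ≤ (n : ℝ) ^ 3),
      abs_of_nonneg (by positivity : (0 : ℝ) ≤ (1 + k + n) ^ 2)]
    norm_num
    gcongr
    · linarith
    · nlinarith [mul_nonneg hk hn]
  calc _ ≤ (1/16 : ℝ) ^ n * (256 * ((n : ℝ) + 1) ^ 3 * ((k + 1) * (n + 1)) ^ 2) := by
        gcongr
        exact gT_bound (k + 1) (by linarith) n
    _ = _ := by ring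

lemma gS_rec (k : ℝ) (hk : 0 ≤ k) :
    gS k = ((k + 1/2) / (k + 1)) ^ 2 * gS (k + 1) := by
  have h1 := ((gSummable (k + 1) (by linarith)).hasSum.mul_left ((k + 1/2) ^ 3)).sub
    ((gSummable k hk).hasSum.mul_left ((k + 1/2) * (k + 1) ^ 2))
  have h2 := h1.tendsto_sum_nat
  simp only [gWZ k hk, Finset.sum_range_sub] at h2
  have h3 : Tendsto (fun n => gV k n - gV k 0) atTop (𝓝 0) := by
    have : gV k 0 = 0 := by simp [gV]
    simpa [this] using gV_tendsto k hk
  have h4 := tendsto_nhds_unique h2 h3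
  change (k + 1/2) ^ 3 * gS (k + 1) - (k + 1/2) * (k + 1) ^ 2 * gS k = 0 at h4
  have e1 : (k + 1/2) ≠ 0 := by positivity
  have e2 : (k + 1) ≠ 0 := by positivity
  have h5 : (k + 1/2) * ((k + 1/2) ^ 2 * gS (k + 1) - (k + 1) ^ 2 * gS k) = 0 := by
    rw [← h4]; ring
  have h6 := (mul_eq_zero.1 h5).resolve_left e1
  rw [div_pow, div_mul_eq_mul_div, eq_div_iff (by positivity)]
  linarith

noncomputable def gA : ℕ → ℝ
  | 0 => 1
  | n + 1 => gA n * (((n : ℝ) + 1/2) ^ 3 / (64 * ((n : ℝ) + 1) ^ 3))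

lemma tendsto_aux (a b : ℝ) : Tendsto (fun k : ℝ => (a - k) / (b + k)) atTop (𝓝 (-1)) := by
  have h : Tendsto (fun k : ℝ => -1 + (a + b) / (b + k)) atTop (𝓝 (-1 + 0)) :=
    tendsto_const_nhds.add
      (tendsto_const_nhds.div_atTop (tendsto_atTop_add_const_left _ _ tendsto_id))
  rw [add_zero] at h
  refine h.congr' ?_
  filter_upwards [eventually_gt_atTop (-b)] with k hk
  have : b + k ≠ 0 := by linarith
  field_simp
  ring

lemma gT_tendsto (n : ℕ) : Tendsto (fun k : ℝ => gT k n) atTop (𝓝 (gA n)) := by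
  induction n with
  | zero => simp [gT, gA]
  | succ n ih =>
    have h := ih.mul (((tendsto_aux (1/2 + 2 * n) (1 + n)).mul
      (tendsto_aux (3/2 + 2 * n) (1 + n))).const_mul
        (((n : ℝ) + 1/2) ^ 3 / (64 * ((n : ℝ) + 1) ^ 3)))
    have e : gA n * (((n : ℝ) + 1/2) ^ 3 / (64 * ((n : ℝ) + 1) ^ 3) * (-1 * -1)) = gA (n + 1) := by
      rw [gA]; ring
    rw [e] at h
    refine h.congr' ?_
    filter_upwards [eventually_gt_atTop 0] with k hk
    rw [gT]
    have e1 : (1 + n + k : ℝ) ≠ 0 := by positivity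
    have e2 : (1 + k + n : ℝ) ≠ 0 := by positivity
    have e3 : (n + 1 : ℝ) ≠ 0 := by positivity
    field_simp
    ring

lemma gS_tendsto : Tendsto (fun k : ℝ => gS k / k) atTop
    (𝓝 (∑' n : ℕ, gA n * (84 * n + 10))) := by
  have h : Tendsto (fun k : ℝ => ∑' n : ℕ, gT k n * gQ k n / k) atTop
      (𝓝 (∑' n : ℕ, gA n * (84 * n + 10))) := by
    refine tendsto_tsum_of_dominated_convergence ((gPow 2).mul_left 502) (fun n => ?_) ?_
    · have h1 : Tendsto (fun k : ℝ => (84 * (n : ℝ) + 10) + (120 * (n : ℝ) ^ 2 + 34 * n + 3) / k) atTop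
          (𝓝 ((84 * (n : ℝ) + 10) + 0)) :=
        tendsto_const_nhds.add (tendsto_const_nhds.div_atTop tendsto_id)
      rw [add_zero] at h1
      refine ((gT_tendsto n).mul h1).congr' ?_
      filter_upwards [eventually_gt_atTop 0] with k hk
      unfold gQ
      field_simp
      ring
    · filter_upwards [eventually_ge_atTop 1] with k hk n
      have hk0 : 0 < k := by linarith
      rw [Real.norm_eq_abs, abs_div, abs_of_pos hk0, div_le_iff₀ hk0]
      refine (gTQ_bound k hk0.le n).trans ?_
      have : 0 ≤ ((n : ℝ) + 1) ^ 2 * (1/16 : ℝ) ^ n := by positivity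
      nlinarith
  refine h.congr fun k => ?_
  rw [tsum_div_const, gS]

lemma gW_pos (n : ℕ) : 0 < Real.Wallis.W n := Real.Wallis.W_pos n

lemma gS_zero (n : ℕ) : gS 0 = gS n / (Real.Wallis.W n * (2 * n + 1)) := by
  induction n with
  | zero => simp [Real.Wallis.W]
  | succ n ih =>
    rw [ih, gS_rec n (Nat.cast_nonneg n), Real.Wallis.W_succ]
    have := gW_pos n
    have e1 : (n + 1 : ℝ) ≠ 0 := by positivity
    have e2 : (2 * n + 1 : ℝ) ≠ 0 := by positivity
    have e3 : (2 * n + 3 : ℝ) ≠ 0 := by positivity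
    have e4 : (2 * (n + 1) + 1 : ℝ) ≠ 0 := by positivity
    push_cast
    field_simp
    ring

lemma gS_half_val : gS (1/2) = 8 := by
  have h0 : ∀ n, gT (1/2) (n + 1) = 0 := by
    intro n
    induction n with
    | zero => simp [gT]
    | succ n ih => rw [gT, ih, zero_mul]
  rw [gS, tsum_eq_single 0]
  · simp [gT, gQ]; norm_num
  · intro n hn
    obtain ⟨m, rfl⟩ := Nat.exists_eq_succ_of_ne_zero hn
    rw [Nat.succ_eq_add_one, h0, zero_mul]

lemma gS_half (n : ℕ) : 8 = gS (n + 1/2) * Real.Wallis.W n / (2 * n + 1) := by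
  induction n with
  | zero => simp [Real.Wallis.W, ← gS_half_val]
  | succ n ih =>
    have e : ((n + 1 : ℕ) : ℝ) + 1/2 = (n + 1/2) + 1 := by push_cast; ring
    rw [ih, gS_rec (n + 1/2) (by positivity), Real.Wallis.W_succ, e]
    have := gW_pos n
    have e1 : (n + 1/2 + 1 : ℝ) ≠ 0 := by positivity
    have e2 : (2 * n + 1 : ℝ) ≠ 0 := by positivity
    have e3 : (2 * n + 3 : ℝ) ≠ 0 := by positivity
    have e4 : (2 * (n + 1) + 1 : ℝ) ≠ 0 := by positivity
    push_cast
    field_simp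
    ring

lemma gS_final : gS 0 = 32 / π ^ 2 := by
  set L := ∑' n : ℕ, gA n * (84 * (n : ℝ) + 10) with hL
  have hW := Real.Wallis.tendsto_W_nhds_pi_div_two
  have hpi := Real.pi_pos
  have hn : Tendsto (fun n : ℕ => (n : ℝ)) atTop atTop := tendsto_natCast_atTop_atTop
  have hn2 : Tendsto (fun n : ℕ => (n : ℝ) + 1/2) atTop atTop :=
    tendsto_atTop_add_const_right _ _ hn
  have h1 : L * (π / 2) / 2 = 8 := by
    have := (((gS_tendsto.comp hn2).mul hW).div_const 2)
    refine tendsto_nhds_unique this ?_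
    refine tendsto_const_nhds.congr fun n => ?_
    rw [gS_half n]
    simp only [Function.comp]
    have e2 : (2 * n + 1 : ℝ) ≠ 0 := by positivity
    have e3 : (n + 1/2 : ℝ) ≠ 0 := by positivity
    field_simp
  have h2 : gS 0 = L / (π / 2) * (1 / 2) := by
    have h3 : Tendsto (fun n : ℕ => (n : ℝ) / (2 * n + 1)) atTop (𝓝 (1/2)) := by
      have h4 : Tendsto (fun n : ℕ => 1/2 - (1/4) / ((n : ℝ) + 1/2)) atTop (𝓝 (1/2 - 0)) :=
        tendsto_const_nhds.sub (tendsto_const_nhds.div_atTop hn2)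
      rw [sub_zero] at h4
      refine h4.congr fun n => ?_
      have e2 : (2 * n + 1 : ℝ) ≠ 0 := by positivity
      have e3 : (n + 1/2 : ℝ) ≠ 0 := by positivity
      field_simp
      ring
    have := (((gS_tendsto.comp hn).div hW (by positivity)).mul h3)
    refine tendsto_nhds_unique ?_ this
    refine tendsto_const_nhds.congr' ?_
    filter_upwards [eventually_gt_atTop 0] with n hn0
    rw [gS_zero n]
    simp only [Function.comp, Pi.div_apply]
    have := gW_pos n
    have e1 : (n : ℝ) ≠ 0 := by positivity
    have e2 : (2 * n + 1 : ℝ) ≠ 0 := by positivity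
    field_simp
  have h5 : L = 32 / π := by
    field_simp
    linarith
  rw [h2, h5]
  field_simp

lemma gT_zero_eq (n : ℕ) : gT 0 n = (1 / 16 ^ n) *
      (poch (1/2) n ^ 3 * poch (1/4) n * poch (3/4) n / (n.factorial : ℝ) ^ 5) := by
  induction n with
  | zero => simp [gT, poch]
  | succ n ih =>
    have hp : ∀ x, poch x (n + 1) = poch x n * (x + n) := fun x => by
      simp [poch, Finset.prod_range_succ]
    rw [gT, ih, hp, hp, hp, Nat.factorial_succ]
    have e0 : (n.factorial : ℝ) ≠ 0 := by positivity
    have e1 : (n + 1 : ℝ) ≠ 0 := by positivity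
    have e2 : (1 + n : ℝ) ≠ 0 := by positivity
    have e3 : (1 + 0 + n : ℝ) ≠ 0 := by positivity
    push_cast
    field_simp
    ring

theorem guillera_inv_pi_sq :
    (32 : ℝ) / π ^ 2 = ∑' n : ℕ, (1 / 16 ^ n) *
      (poch (1/2) n ^ 3 * poch (1/4) n * poch (3/4) n / (n.factorial : ℝ) ^ 5) *
      (3 + 34 * n + 120 * (n : ℝ) ^ 2) := by
  rw [← gS_final, gS]
  refine tsum_congr fun n => ?_
  rw [gT_zero_eq, gQ]
  ring
end

section
/- 128/π² = ∑_{n=0}^∞ (1/16^n) · [(1/2)_n³ (1/4)_n (−1/4)_n / ((1)_n³ (2)_n²)] · (13 + 118n + 120n²). -/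
open Real

lemma poch_succ (x : ℝ) (n : ℕ) : poch x (n+1) = poch x n * (x + n) := by
  unfold poch; rw [Finset.prod_range_succ]

lemma poch_zero (x : ℝ) : poch x 0 = 1 := by simp [poch]

lemma poch_pos (x : ℝ) (hx : 0 < x) (n : ℕ) : 0 < poch x n := by
  unfold poch
  exact Finset.prod_pos (fun i _ => by positivity)

lemma poch_one (n : ℕ) : poch 1 n = (n.factorial : ℝ) := by
  induction n with
  | zero => simp [poch]
  | succ k ih => rw [poch_succ, ih, Nat.factorial_succ]; push_cast; ring

lemma poch_two (n : ℕ) : poch 2 n = ((n+1).factorial : ℝ) := by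
  induction n with
  | zero => simp [poch]
  | succ k ih => rw [poch_succ, ih, Nat.factorial_succ (k+1)]; push_cast; ring

lemma poch_dup (n : ℕ) : poch (-1/2) (2*n) = 4^n * (poch (1/4) n * poch (-1/4) n) := by
  induction n with
  | zero => simp [poch]
  | succ k ih =>
    rw [show 2*(k+1) = 2*k+1+1 by ring, poch_succ, poch_succ, ih, poch_succ, poch_succ]
    push_cast; ring

lemma fact_dup (n : ℕ) : ((2*n).factorial : ℝ) = 4^n * (poch (1/2) n * (n.factorial : ℝ)) := by
  induction n with
  | zero => simp [poch]
  | succ k ih =>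
    rw [show 2*(k+1) = 2*k+1+1 by ring, Nat.factorial_succ, Nat.factorial_succ, Nat.factorial_succ,
      poch_succ]
    push_cast
    rw [ih]; ring

/-- The hypergeometric kernel. -/
noncomputable def wzH (n m : ℕ) : ℝ :=
  poch (3/2) m ^ 2 * poch (1/2) n ^ 4 * poch (1/2) (m+n) ^ 2 * poch (-1/2) (2*n) /
    (((m+2*n).factorial : ℝ) ^ 2 * ((2*n).factorial : ℝ) * ((m+n+1).factorial : ℝ) ^ 2)

noncomputable def wzP (n m : ℝ) : ℝ :=
  13 + 72*m + 140*m^2 + 112*m^3 + 32*m^4 + 170*n + 608*n*m + 696*n*m^2 + 256*n*m^3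
   + 644*n^2 + 1440*n^2*m + 768*n^2*m^2 + 952*n^3 + 1024*n^3*m + 480*n^4

noncomputable def wzG (n m : ℕ) : ℝ := wzH n m * wzP n m / ((m:ℝ)+2*n+1)^2

noncomputable def wzF (n m : ℕ) : ℝ := 32 * wzH n m * n * (4*n+4*m+3)

noncomputable def wzRn (n m : ℝ) : ℝ :=
  (n+1/2)^4*(n+m+1/2)^2*(2*n-1/2)*(2*n+1/2)/
    ((2*n+1)*(2*n+2)*(2*n+m+1)^2*(2*n+m+2)^2*(n+m+2)^2)

noncomputable def wzRm (n m : ℝ) : ℝ :=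
  (m+3/2)^2*(m+n+1/2)^2/((m+2*n+1)^2*(m+n+2)^2)

lemma wzH_n (n m : ℕ) : wzH (n+1) m = wzH n m * wzRn n m := by
  unfold wzH wzRn
  rw [show 2*(n+1) = 2*n+1+1 by ring, show m + (2*n+1+1) = (m+2*n)+1+1 by ring,
    show m+(n+1)+1 = m+n+1+1 by ring, show m + (n+1) = m+n+1 by ring]
  simp only [poch_succ, Nat.factorial_succ]
  push_cast
  have h1 : ((m+2*n).factorial : ℝ) ≠ 0 := by positivity
  have h2 : ((2*n).factorial : ℝ) ≠ 0 := by positivity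
  have h3 : ((m+n).factorial : ℝ) ≠ 0 := by positivity
  have h4 : (2*(n:ℝ)+m+1) ≠ 0 := by positivity
  have h5 : (2*(n:ℝ)+m+2) ≠ 0 := by positivity
  have h6 : ((n:ℝ)+m+2) ≠ 0 := by positivity
  have h7 : ((n:ℝ)+m+1) ≠ 0 := by positivity
  have h8 : (2*(n:ℝ)+1) ≠ 0 := by positivity
  have h9 : (2*(n:ℝ)+2) ≠ 0 := by positivity
  rw [show (m:ℝ)+2*n+1+1 = 2*n+m+2 by ring, show (m:ℝ)+2*n+1 = 2*n+m+1 by ring,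
    show (m:ℝ)+n+1+1 = n+m+2 by ring, show (m:ℝ)+n+1 = n+m+1 by ring,
    show 2*(n:ℝ)+1+1 = 2*n+2 by ring]
  rw [div_mul_div_comm, div_eq_div_iff (by positivity) (by positivity)]
  ring

lemma wzH_m (n m : ℕ) : wzH n (m+1) = wzH n m * wzRm n m := by
  unfold wzH wzRm
  rw [show m + 1 + 2*n = (m+2*n)+1 by ring,
    show m+1+n = m+n+1 by ring]
  simp only [poch_succ, Nat.factorial_succ]
  push_cast
  rw [div_mul_div_comm, div_eq_div_iff (by positivity) (by positivity)]
  ring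

lemma wz_pair (n m : ℕ) : wzF (n+1) m - wzF n m = wzG n (m+1) - wzG n m := by
  unfold wzF wzG
  rw [wzH_n, wzH_m]
  have key : 32 * wzRn n m * ((n:ℝ)+1) * (4*(n+1)+4*m+3) - 32 * n * (4*n+4*m+3)
      = wzRm n m * wzP n (m+1) / ((m:ℝ)+1+2*n+1)^2 - wzP n m / ((m:ℝ)+2*n+1)^2 := by
    unfold wzRn wzRm wzP
    generalize hx : (n:ℝ) = x
    generalize hy : (m:ℝ) = y
    have hx0 : 0 ≤ x := by rw [← hx]; positivity
    have hy0 : 0 ≤ y := by rw [← hy]; positivity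
    have h1 : y+2*x+1 ≠ 0 := by positivity
    have h2 : y+2*x+2 ≠ 0 := by positivity
    have h3 : y+x+2 ≠ 0 := by positivity
    have h4 : 2*x+1 ≠ 0 := by positivity
    have h5 : x+1 ≠ 0 := by positivity
    rw [show 2*x+y+1 = y+2*x+1 by ring, show 2*x+y+2 = y+2*x+2 by ring,
      show x+y+2 = y+x+2 by ring, show y+1+2*x+1 = y+2*x+2 by ring,
      show 2*x+2 = 2*(x+1) by ring]
    field_simp
    ring
  push_cast
  linear_combination wzH n m * key

lemma wzRn_abs (n m : ℕ) : |wzRn n m| ≤ 1/16 := by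
  unfold wzRn
  generalize hx : (n:ℝ) = x
  generalize hy : (m:ℝ) = y
  have hx0 : 0 ≤ x := by rw [← hx]; positivity
  have hy0 : 0 ≤ y := by rw [← hy]; positivity
  rw [abs_div, abs_of_pos (show 0 < (2*x+1)*(2*x+2)*(2*x+y+1)^2*(2*x+y+2)^2*(x+y+2)^2 by positivity),
    div_le_iff₀ (by positivity)]
  rw [abs_mul, abs_mul, abs_mul, abs_of_nonneg (show 0 ≤ (x+1/2)^4 by positivity),
    abs_of_nonneg (show 0 ≤ (x+y+1/2)^2 by positivity),
    abs_of_nonneg (show 0 ≤ 2*x+1/2 by positivity)]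
  have e1 : |2*x-1/2| ≤ 2*x+1 := by rw [abs_le]; constructor <;> linarith
  have e2 : (2*x+1/2) ≤ 2*x+2 := by linarith
  have e3 : (x+y+1/2)^2 ≤ (x+y+2)^2 := by gcongr; linarith
  have e4 : (x+1/2)^4 ≤ 1/16 * ((2*x+y+1)^2*(2*x+y+2)^2) := by
    have a1 : (x+1/2) ≤ 1/2*(2*x+y+1) := by linarith
    have a2 : (x+1/2) ≤ 1/2*(2*x+y+2) := by linarith
    calc (x+1/2)^4 = (x+1/2)^2*(x+1/2)^2 := by ring
      _ ≤ (1/2*(2*x+y+1))^2 * (1/2*(2*x+y+2))^2 := by gcongr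
      _ = _ := by ring
  calc (x+1/2)^4 * (x+y+1/2)^2 * |2*x-1/2| * (2*x+1/2)
      ≤ (1/16 * ((2*x+y+1)^2*(2*x+y+2)^2)) * (x+y+2)^2 * (2*x+1) * (2*x+2) := by gcongr
    _ = _ := by ring

lemma wzRn_abs0 (m : ℕ) : |wzRn 0 m| ≤ 1/16 / ((m:ℝ)+1)^2 := by
  unfold wzRn
  generalize hy : (m:ℝ) = y
  have hy0 : 0 ≤ y := by rw [← hy]; positivity
  rw [abs_div, abs_of_pos (show 0 < (2*0+1)*(2*0+2)*(2*0+y+1)^2*(2*0+y+2)^2*(0+y+2)^2 by positivity),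
    div_le_div_iff₀ (by positivity) (by positivity)]
  rw [show ((0:ℝ)+1/2)^4*(0+y+1/2)^2*(2*0-1/2)*(2*0+1/2) = -((y+1/2)^2/64) by ring, abs_neg,
    abs_of_nonneg (by positivity)]
  have e3 : (y+1/2)^2 ≤ (y+2)^2 := by gcongr; linarith
  have e4 : (1:ℝ)^2 ≤ (y+2)^2 := by gcongr; linarith
  calc (y+1/2)^2/64 * (y+1)^2 ≤ (y+2)^2/64 * (y+1)^2 := by gcongr
    _ = 1^2 * ((y+2)^2/64 * (y+1)^2) := by ring
    _ ≤ (y+2)^2 * ((y+2)^2/64 * (y+1)^2) := by gcongr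
    _ ≤ (y+2)^2 * ((y+2)^2/8 * (y+1)^2) := by gcongr; norm_num
    _ = _ := by ring

lemma wzH0_pos (m : ℕ) : 0 < wzH 0 m := by
  unfold wzH
  have := poch_pos (3/2) (by norm_num) m
  have := poch_pos (1/2) (by norm_num) m
  simp only [poch_zero, Nat.mul_zero, Nat.add_zero]
  positivity

lemma wzH0_le (m : ℕ) : wzH 0 m * ((m:ℝ)+1)^2 ≤ 1 := by
  induction m with
  | zero => simp [wzH, poch]
  | succ k ih =>
    rw [wzH_m]
    have hp := wzH0_pos k
    have : wzRm (0:ℕ) k * ((k:ℝ)+1+1)^2 ≤ ((k:ℝ)+1)^2 := by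
      unfold wzRm
      generalize hy : (k:ℝ) = y
      have hy0 : 0 ≤ y := by rw [← hy]; positivity
      have : (y+3/2)*(y+1/2) ≤ (y+1)^2 := by nlinarith
      have h2 : ((y+3/2)*(y+1/2))^2 ≤ ((y+1)^2)^2 := by gcongr
      rw [div_mul_eq_mul_div, div_le_iff₀ (by push_cast; positivity)]
      push_cast
      calc (y+3/2)^2*(y+0+1/2)^2*(y+1+1)^2 = ((y+3/2)*(y+1/2))^2*(y+2)^2 := by ring
        _ ≤ ((y+1)^2)^2*(y+2)^2 := by gcongr
        _ = _ := by ring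
    push_cast
    calc _ = wzH 0 k * (wzRm (0:ℕ) k * ((k:ℝ)+1+1)^2) := by push_cast; ring
      _ ≤ wzH 0 k * ((k:ℝ)+1)^2 := by gcongr
      _ ≤ 1 := ih

lemma wzH_bound (n m : ℕ) : |wzH n m| * ((m:ℝ)+1)^2 ≤ (1/16)^n := by
  induction n with
  | zero => rw [abs_of_pos (wzH0_pos m)]; simpa using wzH0_le m
  | succ k ih =>
    rw [wzH_n, abs_mul, pow_succ]
    calc |wzH k m| * |wzRn k m| * ((m:ℝ)+1)^2 = (|wzH k m| * ((m:ℝ)+1)^2) * |wzRn k m| := by ring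
      _ ≤ (1/16)^k * (1/16) := by
        gcongr
        exact wzRn_abs k m

lemma wzH_bound' (n m : ℕ) : |wzH (n+1) m| * ((m:ℝ)+1)^4 ≤ 1 := by
  induction n with
  | zero =>
    rw [wzH_n, abs_mul]
    have h1 := wzH_bound 0 m
    have h2 := wzRn_abs0 m
    rw [le_div_iff₀ (by positivity)] at h2
    calc |wzH 0 m| * |wzRn (0:ℕ) m| * ((m:ℝ)+1)^4
        = (|wzH 0 m| * ((m:ℝ)+1)^2) * (|wzRn 0 m| * ((m:ℝ)+1)^2) := by push_cast; ring
      _ ≤ (1/16)^0 * (1/16) := by gcongr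
      _ ≤ 1 := by norm_num
  | succ k ih =>
    rw [wzH_n, abs_mul]
    calc |wzH (k+1) m| * |wzRn (k+1:ℕ) m| * ((m:ℝ)+1)^4
        = (|wzH (k+1) m| * ((m:ℝ)+1)^4) * |wzRn (k+1:ℕ) m| := by ring
      _ ≤ 1 * (1/16) := by
        gcongr
        exact wzRn_abs (k+1) m
      _ ≤ 1 := by norm_num

lemma wzG_abs (n m : ℕ) : |wzG n m| ≤ |wzH n m| * ((m:ℝ)+1)^2 * (32*(2*n+1)^2) := by
  unfold wzG
  rw [abs_div, abs_mul, abs_of_pos (show 0 < ((m:ℝ)+2*n+1)^2 by positivity),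
    div_le_iff₀ (by positivity)]
  have hP : |wzP n m| ≤ 32*((m:ℝ)+2*n+1)^4 := by
    rw [abs_of_nonneg (by unfold wzP; positivity)]
    unfold wzP
    rw [← sub_nonneg]
    ring_nf
    positivity
  have h1 : ((m:ℝ)+2*n+1) ≤ (m+1)*(2*n+1) := by
    have : 0 ≤ (m:ℝ)*n := by positivity
    nlinarith
  calc |wzH n m| * |wzP n m| ≤ |wzH n m| * (32*((m:ℝ)+2*n+1)^4) := by gcongr
    _ = |wzH n m| * (32*((m:ℝ)+2*n+1)^2) * ((m:ℝ)+2*n+1)^2 := by ring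
    _ ≤ |wzH n m| * (32*((m+1)*(2*n+1))^2) * ((m:ℝ)+2*n+1)^2 := by gcongr
    _ = _ := by ring

lemma wzG_dom (n m : ℕ) : |wzG n m| ≤ (1/16)^n * (32*(2*n+1)^2) :=
  (wzG_abs n m).trans (by gcongr; exact wzH_bound n m)

lemma summable_dom : Summable (fun n : ℕ => ((1:ℝ)/16)^n * (32*(2*n+1)^2)) := by
  have h (k : ℕ) := summable_pow_mul_geometric_of_norm_lt_one (R := ℝ) (r := 1/16) k (by norm_num)
  have := (((h 2).mul_left 128).add ((h 1).mul_left 128)).add ((h 0).mul_left 32)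
  refine this.congr (fun n => ?_)
  ring

lemma wzG_summable (m : ℕ) : Summable (fun n => wzG n m) :=
  Summable.of_norm_bounded summable_dom (fun n => by simpa using wzG_dom n m)

open Filter Topology

lemma wzF_tendsto (m : ℕ) : Tendsto (fun n => wzF n m) atTop (𝓝 0) := by
  have hs : Tendsto (fun n : ℕ => (((1:ℝ)/16)^n * (32*(2*n+1)^2)) * (4*m+4)) atTop (𝓝 0) := by
    simpa using summable_dom.tendsto_atTop_zero.mul_const (4*(m:ℝ)+4)
  refine squeeze_zero_norm (fun n => ?_) hs
  have hb := wzH_bound n m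
  have h1 : |wzH n m| ≤ (1/16)^n := by
    refine le_trans ?_ hb
    have : (1:ℝ) ≤ ((m:ℝ)+1)^2 := by
      have : 0 ≤ (m:ℝ) := by positivity
      nlinarith
    exact le_mul_of_one_le_right (abs_nonneg _) this
  unfold wzF
  rw [Real.norm_eq_abs, abs_mul, abs_mul, abs_mul, abs_of_nonneg (show 0 ≤ (n:ℝ) by positivity),
    abs_of_nonneg (show 0 ≤ 4*(n:ℝ)+4*m+3 by positivity), abs_of_nonneg (show (0:ℝ) ≤ 32 by norm_num)]
  have h2 : (n:ℝ) * (4*n+4*m+3) ≤ (2*n+1)^2*(4*m+4) := by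
    rw [← sub_nonneg]
    ring_nf
    positivity
  calc 32 * |wzH n m| * n * (4*n+4*m+3) = 32 * |wzH n m| * (n * (4*n+4*m+3)) := by ring
    _ ≤ 32 * (1/16)^n * ((2*n+1)^2*(4*m+4)) := by gcongr
    _ = _ := by ring

lemma wz_const (m : ℕ) : ∑' n, wzG n (m+1) = ∑' n, wzG n m := by
  have h1 := ((wzG_summable (m+1)).hasSum.sub (wzG_summable m).hasSum).tendsto_sum_nat
  have h2 : (fun N => ∑ n ∈ Finset.range N, (wzG n (m+1) - wzG n m)) = fun N => wzF N m := by
    funext N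
    simp_rw [← wz_pair]
    rw [Finset.sum_range_sub (fun n => wzF n m)]
    simp [wzF]
  rw [h2] at h1
  exact sub_eq_zero.mp (tendsto_nhds_unique h1 (wzF_tendsto m))

lemma wz_const' (m : ℕ) : ∑' n, wzG n m = ∑' n, wzG n 0 := by
  induction m with
  | zero => rfl
  | succ k ih => rw [wz_const, ih]

lemma wallis_poch (m : ℕ) :
    Real.Wallis.W m * (poch (1/2) m * poch (3/2) m) = (m.factorial : ℝ)^2 := by
  induction m with
  | zero => simp [Real.Wallis.W, poch]
  | succ k ih =>
    rw [Real.Wallis.W_succ, poch_succ, poch_succ, Nat.factorial_succ]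
    push_cast
    rw [mul_pow, ← ih]
    have h1 : (2*(k:ℝ)+1) ≠ 0 := by positivity
    have h3 : (2*(k:ℝ)+3) ≠ 0 := by positivity
    field_simp
    ring

lemma wzG0 (m : ℕ) : wzG 0 m =
    (1/Real.Wallis.W m)^2 * (32 - 16 * (1/((m:ℝ)+1)) - 4*(1/((m:ℝ)+1))^2 + (1/((m:ℝ)+1))^4) := by
  have hW := Real.Wallis.W_pos m
  have hw := wallis_poch m
  unfold wzG wzH wzP
  simp only [Nat.mul_zero, Nat.add_zero, poch_zero, Nat.factorial_succ, Nat.factorial_zero]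
  push_cast
  have hf : (m.factorial : ℝ) ≠ 0 := by positivity
  have hx : poch (1/2) m * poch (3/2) m = (m.factorial : ℝ)^2 / Real.Wallis.W m := by
    field_simp; linarith
  rw [show poch (3/2) m ^ 2 * 1 ^ 4 * poch (1/2) m ^ 2 * 1 = (poch (1/2) m * poch (3/2) m)^2 by ring, hx]
  have h1 : ((m:ℝ)+1) ≠ 0 := by positivity
  field_simp
  ring

lemma wzG0_tendsto : Tendsto (fun m => wzG 0 m) atTop (𝓝 (128/π^2)) := by
  simp_rw [wzG0]
  have h1 := tendsto_one_div_add_atTop_nhds_zero_nat (𝕜 := ℝ)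
  have h2 := ((tendsto_const_nhds (x := (1:ℝ))).div Real.Wallis.tendsto_W_nhds_pi_div_two
    (by positivity : π/2 ≠ 0))
  have h3 := (h2.pow 2).mul ((((h1.const_mul 16).const_sub 32).sub ((h1.pow 2).const_mul 4)).add (h1.pow 4))
  have h4 : (1 / (π / 2)) ^ 2 * (32 - 16 * 0 - 4 * 0 ^ 2 + 0 ^ 4) = 128 / π ^ 2 := by
    have := Real.pi_ne_zero
    field_simp
    norm_num
  rw [h4] at h3
  exact h3

lemma wzGn_tendsto (n : ℕ) : Tendsto (fun m => wzG (n+1) m) atTop (𝓝 0) := by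
  have h1 := tendsto_one_div_add_atTop_nhds_zero_nat (𝕜 := ℝ)
  have h2 := (h1.pow 2).const_mul (32*(2*((n+1:ℕ):ℝ)+1)^2)
  refine squeeze_zero_norm (fun m => ?_) (by simpa using h2)
  refine (wzG_abs (n+1) m).trans ?_
  have hb := wzH_bound' n m
  have h3 : |wzH (n+1) m| * ((m:ℝ)+1)^2 ≤ (((m:ℝ)+1)^2)⁻¹ := by
    rw [← one_div, le_div_iff₀ (by positivity)]
    calc _ = |wzH (n+1) m| * ((m:ℝ)+1)^4 := by ring
      _ ≤ 1 := hb
  calc _ ≤ (((m:ℝ)+1)^2)⁻¹ * (32*(2*((n+1:ℕ):ℝ)+1)^2) := by gcongr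
    _ = _ := by simp; ring

theorem series_128_div_pi_sq :
    (128 : ℝ) / π ^ 2 = ∑' n : ℕ, (1 / 16 ^ n) *
      (poch (1/2) n ^ 3 * poch (1/4) n * poch (-1/4) n / (poch 1 n ^ 3 * poch 2 n ^ 2)) *
      (13 + 118 * n + 120 * (n : ℝ) ^ 2) := by
  have hlim : Tendsto (fun m => ∑' n, wzG n m) atTop
      (𝓝 (∑' n : ℕ, if n = 0 then 128/π^2 else 0)) := by
    refine tendsto_tsum_of_dominated_convergence summable_dom (fun n => ?_)
      (Eventually.of_forall fun m n => wzG_dom n m)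
    cases n with
    | zero => simpa using wzG0_tendsto
    | succ k => simpa using wzGn_tendsto k
  simp_rw [wz_const'] at hlim
  rw [tsum_ite_eq] at hlim
  rw [← tendsto_nhds_unique tendsto_const_nhds hlim]
  refine tsum_congr (fun n => ?_)
  unfold wzG wzH wzP
  rw [poch_one, poch_two, Nat.zero_add, Nat.zero_add, poch_zero, poch_dup, fact_dup]
  have hp := (poch_pos (1/2) (by norm_num) n).ne'
  have h1 : (2*(n:ℝ)+1) ≠ 0 := by positivity
  push_cast
  rw [show (16:ℝ)^n = 4^n*4^n by rw [← mul_pow]; norm_num]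
  field_simp
  ring
end

section
/- 256/(3π²) = ∑_{n=0}^∞ (1/16^n) · [(1/2)_n (−1/2)_n (3/2)_n (1/4)_n (3/4)_n / ((1)_n³ (2)_n²)] · (80n³ + 148n² + 80n + 9). -/
open Real

namespace WZ

lemma poch_zero (x : ℝ) : poch x 0 = 1 := by simp [poch]

lemma poch_succ (x : ℝ) (n : ℕ) : poch x (n + 1) = poch x n * (x + n) := by
  simp [poch, Finset.prod_range_succ]

lemma poch_pos (x : ℝ) (hx : 0 < x) (n : ℕ) : 0 < poch x n := by
  unfold poch
  exact Finset.prod_pos fun i _ => by positivity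

/-- `h m = (1/2)_m`, and `f m = (1)_m = m!`. -/
noncomputable def h (m : ℕ) : ℝ := poch (1/2) m
noncomputable def f (m : ℕ) : ℝ := poch 1 m

lemma h_pos (m : ℕ) : 0 < h m := poch_pos _ (by norm_num) _
lemma f_pos (m : ℕ) : 0 < f m := poch_pos _ (by norm_num) _
lemma h_succ (m : ℕ) : h (m + 1) = h m * (1/2 + m) := poch_succ _ _
lemma f_succ (m : ℕ) : f (m + 1) = f m * (1 + m) := poch_succ _ _

/-- The hypergeometric kernel. -/
noncomputable def W (n k : ℕ) : ℝ :=
  h (n + k) ^ 2 * h k ^ 2 * h n ^ 4 * h (2 * n) / (f (n + k) ^ 2 * f (2 * n + k) ^ 2 * f (2 * n))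

lemma W_pos (n k : ℕ) : 0 < W n k := by
  have := h_pos; have := f_pos
  unfold W
  have h1 := h_pos (n + k); have h2 := h_pos k; have h3 := h_pos n; have h4 := h_pos (2 * n)
  have h5 := f_pos (n + k); have h6 := f_pos (2 * n + k); have h7 := f_pos (2 * n)
  positivity

noncomputable def rk (n k : ℝ) : ℝ :=
  (1/2 + (n + k)) ^ 2 * (1/2 + k) ^ 2 / ((1 + (n + k)) ^ 2 * (1 + (2 * n + k)) ^ 2)

noncomputable def rn (n k : ℝ) : ℝ :=
  (1/2 + (n + k)) ^ 2 * (1/2 + n) ^ 4 * ((1/2 + 2 * n) * (1/2 + (2 * n + 1))) /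
   ((1 + (n + k)) ^ 2 * ((1 + (2 * n + k)) * (1 + (2 * n + k + 1))) ^ 2 *
     ((1 + 2 * n) * (1 + (2 * n + 1))))

lemma W_succ_k (n k : ℕ) : W n (k + 1) = W n k * rk n k := by
  unfold W rk
  rw [← add_assoc, ← add_assoc, h_succ, h_succ, f_succ, f_succ]
  have h5 := f_pos (n + k); have h6 := f_pos (2 * n + k); have h7 := f_pos (2 * n)
  push_cast
  have : (0:ℝ) < 1 + (n + k) := by positivity
  have : (0:ℝ) < 1 + (2 * n + k) := by positivity
  field_simp

lemma W_succ_n (n k : ℕ) : W (n + 1) k = W n k * rn n k := by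
  unfold W rn
  rw [show n + 1 + k = n + k + 1 by ring, show 2 * (n + 1) = 2 * n + 1 + 1 by ring,
    show 2 * n + 1 + 1 + k = 2 * n + k + 1 + 1 by ring]
  simp only [h_succ, f_succ]
  have h5 := f_pos (n + k); have h6 := f_pos (2 * n + k); have h7 := f_pos (2 * n)
  push_cast
  have : (0:ℝ) < 1 + (n + k) := by positivity
  have : (0:ℝ) < 1 + (2 * n + k) := by positivity
  have : (0:ℝ) < 1 + (2 * n + k + 1) := by positivity
  have : (0:ℝ) < 1 + (2 * n) := by positivity
  have : (0:ℝ) < 1 + (2 * n + 1) := by positivity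
  field_simp

noncomputable def Q (n k : ℝ) : ℝ :=
  (27/64 + 87/16 * n + 189/8 * n^2 + 93/2 * n^3 + 171/4 * n^4 + 15 * n^5)
  + (21/8 + 91/4 * n + 131/2 * n^2 + 77 * n^3 + 32 * n^4) * k
  + (73/16 + 53/2 * n + 183/4 * n^2 + 24 * n^3) * k^2
  + (7/2 + 23/2 * n + 8 * n^2) * k^3 + (1 + n) * k^4

noncomputable def RF (n k : ℝ) : ℝ :=
  (1/2 + 2 * n + 2 * k) * (n + 1/2) ^ 2 / ((n + k - 1/2) * (n + k + 1))

noncomputable def RG (n k : ℝ) : ℝ :=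
  (n + 1/2) ^ 2 * Q n k /
    ((n + k - 1/2) * (n + k + 1) * (2 * n + k + 1) ^ 2 * ((2 * n + 1) * (n + 1)))

lemma half_ne (m : ℕ) : (m : ℝ) - 1/2 ≠ 0 := by
  intro hm
  have : (2 * m : ℝ) = 1 := by linarith
  norm_cast at this
  omega

lemma half_bd (m : ℕ) : ((m : ℝ) + 1) / 4 ≤ |(m : ℝ) - 1/2| := by
  rcases Nat.eq_zero_or_pos m with rfl | hm
  · norm_num [abs_of_neg]
  · have : (1:ℝ) ≤ m := by exact_mod_cast hm
    rw [abs_of_pos (by linarith)]; linarith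

noncomputable def F (n k : ℕ) : ℝ := W n k * RF n k
noncomputable def G (n k : ℕ) : ℝ := W n k * RG n k

lemma rat_id (n k : ℝ) (hn : 0 ≤ n) (hk : 0 ≤ k) (h1 : n + k - 1/2 ≠ 0) :
    rk n k * RG n (k + 1) - RG n k = rn n k * RF (n + 1) k - RF n k := by
  unfold rk rn RG RF Q
  have e1 : n + (k + 1) - 1/2 = n + k + 1/2 := by ring
  have e2 : n + 1 + k - 1/2 = n + k + 1/2 := by ring
  rw [e1, e2]
  have h2 : n + k + 1/2 ≠ 0 := by positivity
  generalize hx : n + k - 1/2 = x at *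
  have hn' : k = x - n + 1/2 := by linarith
  have : 1 + (n + k) ≠ 0 := by positivity
  have : (n + k) + 1 ≠ 0 := by positivity
  have : n + (k + 1) + 1 ≠ 0 := by positivity
  have : n + 1 + k + 1 ≠ 0 := by positivity
  have : 1 + (2 * n + k) ≠ 0 := by positivity
  have : 1 + (2 * n + k + 1) ≠ 0 := by positivity
  have : 2 * n + k + 1 ≠ 0 := by positivity
  have : 2 * n + (k + 1) + 1 ≠ 0 := by positivity
  have : 1 + 2 * n ≠ 0 := by positivity
  have : 2 * n + 1 ≠ 0 := by positivity
  have : n + 1 ≠ 0 := by positivity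
  have : 1 + (2 * n + 1) ≠ 0 := by positivity
  field_simp
  subst hx
  ring

lemma wz (n k : ℕ) : G n (k + 1) - G n k = F (n + 1) k - F n k := by
  unfold G F
  rw [W_succ_k, W_succ_n]
  have := rat_id n k (by positivity) (by positivity)
    (by have := half_ne (n + k); push_cast at this; exact this)
  push_cast
  linear_combination W n k * this

/-- Antidifference of `F 0`. -/
noncomputable def g (k : ℕ) : ℝ := -2 * W 0 k * k ^ 3 / (k - 1/2) * 1

lemma g_succ (k : ℕ) : g (k + 1) - g k = F 0 k := by
  unfold g F RF
  rw [W_succ_k]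
  unfold rk
  have h1 := half_ne k
  have h2 := half_ne (k + 1)
  push_cast at h2 ⊢
  have e1 : (k : ℝ) + 1 - 1/2 = k + 1/2 := by ring
  rw [e1]
  have h2 : (k : ℝ) + 1/2 ≠ 0 := by positivity
  have e3 : (0 : ℝ) + k - 1/2 = k - 1/2 := by ring
  rw [e3]
  generalize hx : (k : ℝ) - 1/2 = x at *
  have : (k : ℝ) + 1 ≠ 0 := by positivity
  have : (0 : ℝ) + k + 1 ≠ 0 := by positivity
  have : 1 + ((0 : ℝ) + k) ≠ 0 := by positivity
  have : 1 + (2 * (0 : ℝ) + k) ≠ 0 := by positivity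
  field_simp
  subst hx
  ring

lemma rn_le (n k : ℝ) (hn : 0 ≤ n) (hk : 0 ≤ k) : rn n k ≤ 1/16 := by
  have a1 : (1/2 + (n + k)) ^ 2 ≤ (1 + (n + k)) ^ 2 := by gcongr; norm_num
  have a2 : 16 * (1/2 + n) ^ 4 ≤ ((1 + (2 * n + k)) * (1 + (2 * n + k + 1))) ^ 2 := by
    calc 16 * (1/2 + n) ^ 4 = ((1 + 2 * n) * (1 + 2 * n)) ^ 2 := by ring
      _ ≤ _ := by gcongr <;> linarith
  have a3 : (1/2 + 2 * n) * (1/2 + (2 * n + 1)) ≤ (1 + 2 * n) * (1 + (2 * n + 1)) := by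
    gcongr <;> norm_num
  unfold rn
  rw [div_le_iff₀ (by positivity)]
  have : (1/2 + (n + k)) ^ 2 * (16 * (1/2 + n) ^ 4) * ((1/2 + 2 * n) * (1/2 + (2 * n + 1))) ≤
     (1 + (n + k)) ^ 2 * ((1 + (2 * n + k)) * (1 + (2 * n + k + 1))) ^ 2 *
     ((1 + 2 * n) * (1 + (2 * n + 1))) := by gcongr
  linarith

lemma W_le (n k : ℕ) : W n k ≤ W 0 k * (1/16) ^ n := by
  induction n with
  | zero => simp
  | succ n ih =>
    rw [W_succ_n, pow_succ, ← mul_assoc]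
    have := rn_le n k (by positivity) (by positivity)
    have := W_pos 0 k
    have : 0 ≤ rn n k := by unfold rn; positivity
    gcongr

lemma Q_nonneg (n k : ℝ) (hn : 0 ≤ n) (hk : 0 ≤ k) : 0 ≤ Q n k := by
  unfold Q; positivity

lemma Q_le (n k : ℝ) (hn : 0 ≤ n) (hk : 0 ≤ k) : Q n k ≤ 16 * ((n + 1) * (n + k + 1) ^ 4) := by
  have : 0 ≤ 16 * ((n + 1) * (n + k + 1) ^ 4) - Q n k := by
    unfold Q
    ring_nf
    positivity
  linarith

lemma RG_le (n k : ℕ) : |RG n k| ≤ 64 * (n + 1) ^ 2 := by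
  have hb := half_bd (n + k)
  push_cast at hb
  unfold RG
  have hQ := Q_le n k (by positivity) (by positivity)
  have hQ0 := Q_nonneg n k (by positivity) (by positivity)
  rw [abs_div, abs_mul, abs_mul, abs_mul, abs_mul, abs_of_nonneg hQ0,
    abs_of_nonneg (a := ((n:ℝ) + 1/2) ^ 2) (by positivity),
    abs_of_nonneg (a := ((n:ℝ) + k + 1)) (by positivity),
    abs_of_nonneg (a := (2 * (n:ℝ) + k + 1) ^ 2) (by positivity),
    abs_of_nonneg (a := (2 * (n:ℝ) + 1) * (n + 1)) (by positivity)]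
  have hp : 0 < |(n:ℝ) + k - 1/2| := lt_of_lt_of_le (by positivity) hb
  rw [div_le_iff₀ (by positivity)]
  have hn : (0:ℝ) ≤ n := by positivity
  have hk : (0:ℝ) ≤ k := by positivity
  calc ((n:ℝ) + 1/2) ^ 2 * Q n k ≤ ((n:ℝ) + 1) ^ 2 * (16 * ((n + 1) * (n + k + 1) ^ 4)) := by
        gcongr; norm_num
    _ = 64 * ((n:ℝ) + 1) ^ 2 * ((n + k + 1) / 4 * (n + k + 1) * (n + k + 1) ^ 2 * (1 * (n + 1))) := by
        ring
    _ ≤ _ := by gcongr <;> linarith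

lemma RF_le (n k : ℕ) : |RF n k| ≤ 8 * (n + 1) ^ 2 := by
  have hb := half_bd (n + k)
  push_cast at hb
  unfold RF
  rw [abs_div, abs_mul, abs_mul,
    abs_of_nonneg (a := ((n:ℝ) + 1/2) ^ 2) (by positivity),
    abs_of_nonneg (a := ((n:ℝ) + k + 1)) (by positivity),
    abs_of_nonneg (a := (1/2 + 2 * (n:ℝ) + 2 * k)) (by positivity)]
  have hp : 0 < |(n:ℝ) + k - 1/2| := lt_of_lt_of_le (by positivity) hb
  rw [div_le_iff₀ (by positivity)]
  have hn : (0:ℝ) ≤ n := by positivity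
  have hk : (0:ℝ) ≤ k := by positivity
  calc (1/2 + 2 * (n:ℝ) + 2 * k) * ((n:ℝ) + 1/2) ^ 2
      ≤ (2 * (n + k + 1)) * ((n:ℝ) + 1) ^ 2 := by
        gcongr
        · linarith
        · norm_num
    _ ≤ 8 * ((n:ℝ) + 1) ^ 2 * ((n + k + 1) / 4 * (n + k + 1)) := by
        have : (0:ℝ) ≤ ((n:ℝ) + 1) ^ 2 * (n + k + 1) * (n + k) := by positivity
        nlinarith
    _ ≤ _ := by gcongr

lemma sq_le (n : ℕ) : ((n:ℝ) + 1) ^ 2 ≤ 4 ^ n := by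
  have : (n:ℝ) + 1 ≤ 2 ^ n := by exact_mod_cast Nat.lt_two_pow_self
  calc ((n:ℝ) + 1) ^ 2 ≤ (2 ^ n) ^ 2 := by gcongr
    _ = 4 ^ n := by rw [← pow_mul, mul_comm, pow_mul]; norm_num

lemma bd (A : ℝ) (R : ℝ) (hA : 0 ≤ A) (n k : ℕ) (hR : |R| ≤ A * (n + 1) ^ 2) :
    |W n k * R| ≤ A * W 0 k * (1/4) ^ n := by
  have := W_pos 0 k
  rw [abs_mul, abs_of_pos (W_pos n k)]
  calc W n k * |R| ≤ (W 0 k * (1/16) ^ n) * (A * 4 ^ n) := by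
        gcongr
        · exact W_le n k
        · exact hR.trans (by gcongr; exact sq_le n)
    _ = A * W 0 k * ((1/16) ^ n * 4 ^ n) := by ring
    _ = _ := by rw [← mul_pow]; norm_num

lemma G_bd (n k : ℕ) : |G n k| ≤ 64 * W 0 k * (1/4) ^ n :=
  bd 64 _ (by norm_num) n k (RG_le n k)

lemma F_bd (n k : ℕ) : |F n k| ≤ 8 * W 0 k * (1/4) ^ n :=
  bd 8 _ (by norm_num) n k (RF_le n k)

lemma G_summable (k : ℕ) : Summable fun n => G n k := by
  refine Summable.of_norm_bounded (g := fun n => 64 * W 0 k * (1/4 : ℝ) ^ n) ?_ (fun n => G_bd n k)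
  exact (summable_geometric_of_lt_one (by norm_num) (by norm_num)).mul_left _

lemma F_tendsto (k : ℕ) : Filter.Tendsto (fun n => F n k) Filter.atTop (nhds 0) := by
  refine squeeze_zero_norm (a := fun n => 8 * W 0 k * (1/4 : ℝ) ^ n) (fun n => F_bd n k) ?_
  simpa using (tendsto_pow_atTop_nhds_zero_of_lt_one (r := (1/4:ℝ)) (by norm_num)
    (by norm_num)).const_mul (8 * W 0 k)

noncomputable def S (k : ℕ) : ℝ := ∑' n, G n k

lemma S_bd (k : ℕ) : ‖S k‖ ≤ 64 * W 0 k * (4/3) := by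
  refine tsum_of_norm_bounded (f := fun n => G n k) ?_ (fun n => G_bd n k)
  have := (hasSum_geometric_of_lt_one (r := (1/4:ℝ)) (by norm_num) (by norm_num)).mul_left
    (64 * W 0 k)
  norm_num at this ⊢
  exact this

lemma S_succ (k : ℕ) : S (k + 1) - S k = - F 0 k := by
  unfold S
  rw [← (G_summable (k + 1)).tsum_sub (G_summable k)]
  have hs := ((G_summable (k + 1)).sub (G_summable k)).hasSum.tendsto_sum_nat
  refine tendsto_nhds_unique hs ?_
  have : ∀ N, ∑ n ∈ Finset.range N, (G n (k + 1) - G n k) = F N k - F 0 k := by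
    intro N
    rw [← Finset.sum_range_sub (fun n => F n k)]
    exact Finset.sum_congr rfl fun n _ => wz n k
  simp only [this]
  simpa using (F_tendsto k).sub_const (F 0 k)

lemma S_zero (k : ℕ) : S 0 = S k + g k := by
  induction k with
  | zero => simp [g]
  | succ k ih =>
    have := S_succ k
    have := g_succ k
    linarith

lemma wallis (k : ℕ) : Real.Wallis.W k * ((h k / f k) ^ 2 * (2 * k + 1)) = 1 := by
  induction k with
  | zero => simp [Real.Wallis.W, h, f, poch]
  | succ k ih =>
    rw [Real.Wallis.W_succ, h_succ, f_succ]
    refine Eq.trans ?_ ih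
    have := f_pos k
    push_cast
    field_simp
    try ring

lemma lim_c : Filter.Tendsto (fun k : ℕ => (h k / f k) ^ 2 * (2 * k + 1)) Filter.atTop
    (nhds (2 / π)) := by
  have h1 := Real.Wallis.tendsto_W_nhds_pi_div_two.inv₀ (by positivity)
  have h2 : (π / 2)⁻¹ = 2 / π := by rw [inv_div]
  rw [h2] at h1
  refine h1.congr fun k => ?_
  exact inv_eq_of_mul_eq_one_right (wallis k)

lemma W0 (k : ℕ) : W 0 k = ((h k / f k) ^ 2) ^ 2 := by
  have := f_pos k
  simp only [W, zero_add, mul_zero]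
  have h0 : h 0 = 1 := poch_zero _
  have f0 : f 0 = 1 := poch_zero _
  rw [h0, f0]
  field_simp

lemma lim_inv : Filter.Tendsto (fun k : ℕ => ((k : ℝ) + 1)⁻¹) Filter.atTop (nhds 0) :=
  by simpa using tendsto_one_div_add_atTop_nhds_zero_nat (𝕜 := ℝ)

lemma lim_inv2 : Filter.Tendsto (fun k : ℕ => ((k : ℝ))⁻¹) Filter.atTop (nhds 0) :=
  tendsto_inv_atTop_nhds_zero_nat

lemma lim_W0 : Filter.Tendsto (fun k : ℕ => W 0 k) Filter.atTop (nhds 0) := by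
  have h1 : Filter.Tendsto (fun k : ℕ => (((h k / f k) ^ 2 * (2 * k + 1)) * ((k : ℝ) + 1)⁻¹) ^ 2)
    Filter.atTop (nhds 0) := by simpa using (lim_c.mul lim_inv).pow 2
  refine squeeze_zero (fun k => (W_pos 0 k).le) (fun k => ?_) h1
  rw [W0]
  have hk : (1:ℝ) ≤ (2 * k + 1) * ((k : ℝ) + 1)⁻¹ := by
    rw [← div_eq_mul_inv, le_div_iff₀ (by positivity)]
    have : (0:ℝ) ≤ k := by positivity
    linarith
  rw [mul_assoc]
  have : 0 ≤ (h k / f k) ^ 2 := by positivity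
  gcongr
  nlinarith

lemma lim_S : Filter.Tendsto S Filter.atTop (nhds 0) := by
  refine squeeze_zero_norm S_bd ?_
  simpa using (lim_W0.const_mul 64).mul_const (4/3)

lemma lim_g : Filter.Tendsto g Filter.atTop (nhds (-2 / π ^ 2)) := by
  have h1 : Filter.Tendsto (fun k : ℕ => -2 * ((h k / f k) ^ 2 * (2 * k + 1)) ^ 2 *
      ((2 + (k:ℝ)⁻¹) ^ 2 * (1 - 1/2 * (k:ℝ)⁻¹))⁻¹) Filter.atTop
      (nhds (-2 * (2 / π) ^ 2 * ((2 + 0) ^ 2 * (1 - 1/2 * 0))⁻¹)) := by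
    refine ((lim_c.pow 2).const_mul (-2)).mul (Filter.Tendsto.inv₀ ?_ (by norm_num))
    exact ((lim_inv2.const_add 2).pow 2).mul ((lim_inv2.const_mul (1/2)).const_sub 1)
  have e : -2 * (2 / π) ^ 2 * ((2 + 0) ^ 2 * (1 - 1/2 * 0))⁻¹ = -2 / π ^ 2 := by
    have := pi_pos
    field_simp
    norm_num
  rw [e] at h1
  refine h1.congr' ?_
  filter_upwards [Filter.eventually_ge_atTop 1] with k hk
  have hk' : (1:ℝ) ≤ k := by exact_mod_cast hk
  unfold g
  rw [W0]
  generalize (h k / f k) ^ 2 = c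
  have h2 : (1 - 1/2 * (k:ℝ)⁻¹) = (k - 1/2) * (k:ℝ)⁻¹ := by
    field_simp
  have h3 : (2 + (k:ℝ)⁻¹) = (2 * k + 1) * (k:ℝ)⁻¹ := by field_simp
  rw [h2, h3]
  have h4 := half_ne k
  generalize hx : (k : ℝ) - 1/2 = x at *
  field_simp

lemma S_zero_eq : S 0 = -2 / π ^ 2 := by
  have h1 := lim_S.add lim_g
  rw [zero_add] at h1
  refine tendsto_nhds_unique ?_ h1
  refine tendsto_const_nhds.congr fun k => S_zero k

lemma term0 (n : ℕ) : (1 / 16 ^ n : ℝ) *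
      (poch (1/2) n * poch (-1/2) n * poch (3/2) n * poch (1/4) n * poch (3/4) n /
        (poch 1 n ^ 3 * poch 2 n ^ 2)) =
      -(128/3) * (W n 0 * ((n + 1/2) ^ 4 * (3/16) /
        ((n - 1/2) * (n + 1) ^ 2 * (2 * n + 1) ^ 3))) := by
  induction n with
  | zero => simp [poch, W, h, f]; norm_num
  | succ n ih =>
    rw [W_succ_n]
    simp only [poch_succ, pow_succ (16:ℝ) n]
    have h1 := poch_pos 1 (by norm_num) n
    have h2 := poch_pos 2 (by norm_num) n
    have e : ∀ a b c d e p q s : ℝ, 0 < p → 0 < q → 0 < s → 1 / (s * 16) *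
      (a * (1/2 + n) * (b * (-1/2 + n)) * (c * (3/2 + n)) * (d * (1/4 + n)) * (e * (3/4 + n)) /
        ((p * (1 + n)) ^ 3 * (q * (2 + n)) ^ 2)) =
        (1 / s * (a * b * c * d * e / (p ^ 3 * q ^ 2))) *
        ((1/16) * ((1/2 + n) * (-1/2 + n) * (3/2 + n) * (1/4 + n) * (3/4 + n) /
          ((1 + n) ^ 3 * (2 + n) ^ 2))) := by
      intro a b c d e p q s hp hq hs
      have : (0:ℝ) < 1 + n := by positivity
      have : (0:ℝ) < 2 + n := by positivity
      field_simp
    rw [e _ _ _ _ _ _ _ _ h1 h2 (by positivity), ih]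
    unfold rn
    have h3 := half_ne n
    have h4 : -1/2 + (n:ℝ) = n - 1/2 := by ring
    rw [h4]
    push_cast
    have h5 : (n:ℝ) + 1 - 1/2 = n + 1/2 := by ring
    rw [h5]
    generalize hy : W n 0 = w
    generalize hx : (n : ℝ) - 1/2 = x at *
    simp only [add_zero]
    have : (n:ℝ) + 1/2 ≠ 0 := by positivity
    have : (1:ℝ) + n ≠ 0 := by positivity
    have : (2:ℝ) + n ≠ 0 := by positivity
    have : (n:ℝ) + 1 ≠ 0 := by positivity
    have : (n:ℝ) + 1 + 1 ≠ 0 := by positivity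
    have : 2 * (n:ℝ) + 1 ≠ 0 := by positivity
    have : 1 + 2 * (n:ℝ) ≠ 0 := by positivity
    have : 2 * ((n:ℝ) + 1) + 1 ≠ 0 := by positivity
    have : 1 + (2 * (n:ℝ) + 1) ≠ 0 := by positivity
    field_simp
    ring

lemma term (n : ℕ) : (1 / 16 ^ n) *
      (poch (1/2) n * poch (-1/2) n * poch (3/2) n * poch (1/4) n * poch (3/4) n /
        (poch 1 n ^ 3 * poch 2 n ^ 2)) *
      (80 * (n : ℝ) ^ 3 + 148 * (n : ℝ) ^ 2 + 80 * n + 9) = -(128/3) * G n 0 := by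
  rw [term0]
  unfold G RG Q
  have h3 := half_ne n
  push_cast
  simp only [add_zero]
  generalize hx : (n : ℝ) - 1/2 = x at *
  have : (n:ℝ) + 1 ≠ 0 := by positivity
  have : 2 * (n:ℝ) + 1 ≠ 0 := by positivity
  field_simp
  ring

end WZ

theorem series_256_div_3pi_sq :
    (256 : ℝ) / (3 * π ^ 2) = ∑' n : ℕ, (1 / 16 ^ n) *
      (poch (1/2) n * poch (-1/2) n * poch (3/2) n * poch (1/4) n * poch (3/4) n /
        (poch 1 n ^ 3 * poch 2 n ^ 2)) *
      (80 * (n : ℝ) ^ 3 + 148 * (n : ℝ) ^ 2 + 80 * n + 9) := by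
  simp only [WZ.term]
  rw [tsum_mul_left]
  have h := WZ.S_zero_eq
  unfold WZ.S at h
  rw [h]
  have := pi_pos
  field_simp
  norm_num
end

section
/- 512/π² = ∑_{n=0}^∞ (1/16^n) · [(1/2)_n (1/2)_n (3/2)_n (3/4)_n (5/4)_n / ((1)_n³ (2)_n²)] · (240n³ + 532n² + 336n + 45). -/
open Real

namespace GuilleraAux

/-- `(1/2)_m / m!`. -/
noncomputable def u : ℕ → ℝ
  | 0 => 1
  | m + 1 => u m * ((2 * m + 1) / (2 * m + 2))

/-- Inverse of the binomial coefficient `C(2n+k, n)`. -/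
noncomputable def c (n k : ℕ) : ℝ :=
  (n.factorial : ℝ) * ((n + k).factorial : ℝ) / ((2 * n + k).factorial : ℝ)

noncomputable def U (n k : ℕ) : ℝ := u n ^ 3 * u (n + k) ^ 3 * u (2 * n + k) * c n k ^ 2

noncomputable def p (n k : ℝ) : ℝ :=
  3/16 + 13/8*k + 11/2*k^2 + 9*k^3 + 7*k^4 + 2*k^5 + 13/4*n + 45/2*n*k + 54*n*k^2 + 55*n*k^3
  + 20*n*k^4 + 45/2*n^2 + 108*n^2*k + 162*n^2*k^2 + 78*n^2*k^3 + 72*n^3 + 214*n^3*k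
  + 152*n^3*k^2 + 107*n^4 + 150*n^4*k + 60*n^5

noncomputable def G (n k : ℕ) : ℝ := U n k * (p n k / (2 * n + k + 1) ^ 3)

noncomputable def F (n k : ℕ) : ℝ := U n k * (n * (6 * n + 4 * k + 1))

lemma u_succ (m : ℕ) : u (m + 1) = u m * ((2 * m + 1) / (2 * m + 2)) := rfl

lemma u_pos (m : ℕ) : 0 < u m := by
  induction m with
  | zero => simp [u]
  | succ m ih => rw [u_succ]; positivity

lemma u_succ_le (m : ℕ) : u (m + 1) ≤ u m := by
  rw [u_succ]
  have := u_pos m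
  have h : (2 * (m:ℝ) + 1) / (2 * m + 2) ≤ 1 := by
    rw [div_le_one (by positivity)]; linarith
  nlinarith

lemma u_anti : Antitone u := antitone_nat_of_succ_le u_succ_le

lemma u_le_one (m : ℕ) : u m ≤ 1 := by
  have := u_anti (Nat.zero_le m); simpa [u] using this

lemma u_sq_le (m : ℕ) : u m ^ 2 * (2 * m + 1) ≤ 1 := by
  induction m with
  | zero => simp [u]
  | succ m ih =>
    rw [u_succ]
    push_cast
    have h : (u m * ((2 * (m:ℝ) + 1) / (2 * m + 2))) ^ 2 * (2 * (m + 1) + 1)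
        = (u m ^ 2 * (2 * m + 1)) * ((2 * m + 1) * (2 * m + 3) / (2 * m + 2) ^ 2) := by
      field_simp; ring
    rw [h]
    have h2 : (2 * (m:ℝ) + 1) * (2 * m + 3) / (2 * m + 2) ^ 2 ≤ 1 := by
      rw [div_le_one (by positivity)]; nlinarith
    exact mul_le_one₀ ih (by positivity) h2

lemma u_wallis (m : ℕ) : u m ^ 2 * (2 * m + 1) = (Real.Wallis.W m)⁻¹ := by
  induction m with
  | zero => simp [u, Real.Wallis.W]
  | succ m ih =>
    rw [Real.Wallis.W_succ, mul_inv, ← ih, u_succ]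
    push_cast
    field_simp
    ring

lemma c_pos (n k : ℕ) : 0 < c n k := by unfold c; positivity

lemma c_succ_left (n k : ℕ) : c (n + 1) k =
    c n k * ((n + 1) * (n + k + 1) / ((2 * n + k + 1) * (2 * n + k + 2))) := by
  unfold c
  have e1 : n + 1 + k = (n + k) + 1 := by ring
  have e2 : 2 * (n + 1) + k = (2 * n + k) + 1 + 1 := by ring
  rw [e1, e2, Nat.factorial_succ, Nat.factorial_succ, Nat.factorial_succ, Nat.factorial_succ]
  push_cast
  have := Nat.factorial_ne_zero (2 * n + k)
  field_simp
  ring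

lemma c_succ_right (n k : ℕ) : c n (k + 1) =
    c n k * ((n + k + 1) / (2 * n + k + 1)) := by
  unfold c
  have e1 : n + (k + 1) = (n + k) + 1 := by ring
  have e2 : 2 * n + (k + 1) = (2 * n + k) + 1 := by ring
  rw [e1, e2, Nat.factorial_succ, Nat.factorial_succ]
  push_cast
  have := Nat.factorial_ne_zero (2 * n + k)
  field_simp

lemma c_zero (k : ℕ) : c 0 k = 1 := by
  unfold c
  have : ((k.factorial : ℕ) : ℝ) ≠ 0 := Nat.cast_ne_zero.2 (Nat.factorial_ne_zero k)
  simp [this]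

lemma c_succ_le (n k : ℕ) : c (n + 1) k ≤ c n k * (1 / 2) := by
  rw [c_succ_left]
  apply mul_le_mul_of_nonneg_left _ (c_pos n k).le
  rw [div_le_div_iff₀ (by positivity) (by positivity)]
  have : (0:ℝ) ≤ n := by positivity
  have : (0:ℝ) ≤ k := by positivity
  have : (0:ℝ) ≤ n * k := by positivity
  have : (0:ℝ) ≤ n * n := by positivity
  have : (0:ℝ) ≤ k * k := by positivity
  nlinarith

lemma c_le_pow (n k : ℕ) : c n k ≤ (1 / 2) ^ n := by
  induction n with
  | zero => simp [c_zero]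
  | succ n ih =>
    rw [pow_succ]
    exact (c_succ_le n k).trans (by gcongr)

lemma c_le_k (n k : ℕ) : c (n + 1) k ≤ 1 / (k + 1) := by
  induction n with
  | zero =>
    rw [c_succ_left, c_zero]
    rw [one_mul, div_le_div_iff₀ (by positivity) (by positivity)]
    push_cast
    have : (0:ℝ) ≤ k := by positivity
    nlinarith
  | succ n ih =>
    have := c_succ_le (n + 1) k
    have := c_pos (n + 1) k
    linarith

lemma U_nonneg (n k : ℕ) : 0 ≤ U n k := by
  have := u_pos n
  have := u_pos (n + k)
  have := u_pos (2 * n + k)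
  have := c_pos n k
  unfold U; positivity

lemma U_le (n k : ℕ) : U n k * (2 * n + 2 * k + 1) ^ 2 ≤ c n k ^ 2 := by
  have h0 := u_pos n
  have h1 := u_pos (n + k)
  have h2 := u_pos (2 * n + k)
  have h3 : u (2 * n + k) ≤ u (n + k) := u_anti (by omega)
  have h4 := u_sq_le (n + k)
  push_cast at h4
  have h5 : u n ^ 3 ≤ 1 := pow_le_one₀ h0.le (u_le_one n)
  have h6 : (u (n + k) ^ 2 * (2 * (n + k) + 1)) ^ 2 ≤ 1 := pow_le_one₀ (by positivity) h4
  unfold U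
  calc u n ^ 3 * u (n + k) ^ 3 * u (2 * n + k) * c n k ^ 2 * (2 * n + 2 * k + 1) ^ 2
      ≤ 1 * u (n + k) ^ 3 * u (n + k) * c n k ^ 2 * (2 * n + 2 * k + 1) ^ 2 := by gcongr
    _ = (u (n + k) ^ 2 * (2 * (n + k) + 1)) ^ 2 * c n k ^ 2 := by ring
    _ ≤ 1 * c n k ^ 2 := by gcongr
    _ = _ := one_mul _

lemma U_succ_left (n k : ℕ) : U (n + 1) k = U n k *
    (((2 * n + 1) ^ 3 * (2 * n + 2 * k + 1) ^ 3 * (4 * n + 2 * k + 1) * (4 * n + 2 * k + 3)) /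
      (256 * ((2 * n + k + 1) * (2 * n + k + 2)) ^ 3 * (n + k + 1) * (n + 1))) := by
  unfold U
  have e1 : n + 1 + k = (n + k) + 1 := by ring
  have e2 : 2 * (n + 1) + k = (2 * n + k) + 1 + 1 := by ring
  rw [e1, e2, c_succ_left, u_succ, u_succ, u_succ, u_succ]
  push_cast
  field_simp
  ring

lemma U_succ_right (n k : ℕ) : U n (k + 1) = U n k *
    (((2 * n + 2 * k + 1) ^ 3 * (4 * n + 2 * k + 1)) /
      (16 * (2 * n + k + 1) ^ 3 * (n + k + 1))) := by
  unfold U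
  have e1 : n + (k + 1) = (n + k) + 1 := by ring
  have e2 : 2 * n + (k + 1) = (2 * n + k) + 1 := by ring
  rw [e1, e2, c_succ_right, u_succ, u_succ]
  push_cast
  field_simp
  ring

lemma wz (n k : ℕ) : G n (k + 1) - G n k = F (n + 1) k - F n k := by
  unfold G F
  rw [U_succ_left, U_succ_right]
  unfold p
  push_cast
  field_simp
  ring

lemma p_bound (n k : ℕ) : p n k / (2 * n + k + 1) ^ 3 ≤ 10 * (2 * n + 2 * k + 1) ^ 2 := by
  rw [div_le_iff₀ (by positivity), ← sub_nonneg]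
  unfold p
  ring_nf
  positivity

lemma p_nonneg (n k : ℕ) : 0 ≤ p n k / (2 * n + k + 1) ^ 3 := by
  unfold p; positivity

lemma G_nonneg (n k : ℕ) : 0 ≤ G n k := mul_nonneg (U_nonneg n k) (p_nonneg n k)

lemma G_le (n k : ℕ) : G n k ≤ 10 * c n k ^ 2 := by
  have h1 := mul_le_mul_of_nonneg_left (p_bound n k) (U_nonneg n k)
  have h2 := U_le n k
  unfold G
  linarith

lemma F_nonneg (n k : ℕ) : 0 ≤ F n k := mul_nonneg (U_nonneg n k) (by positivity)

lemma F_le (n k : ℕ) : F n k ≤ 10 * c n k ^ 2 := by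
  have h0 : (n:ℝ) * (6 * n + 4 * k + 1) ≤ 10 * (2 * n + 2 * k + 1) ^ 2 := by
    rw [← sub_nonneg]; ring_nf; positivity
  have h1 := mul_le_mul_of_nonneg_left h0 (U_nonneg n k)
  have h2 := U_le n k
  unfold F
  linarith

lemma c_sq_le (n k : ℕ) : c n k ^ 2 ≤ (1 / 4) ^ n := by
  have := pow_le_pow_left₀ (c_pos n k).le (c_le_pow n k) 2
  rw [← pow_mul, mul_comm, pow_mul] at this
  norm_num at this ⊢
  exact this

lemma summable_bd : Summable (fun n : ℕ => 10 * (1 / 4 : ℝ) ^ n) :=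
  (summable_geometric_of_lt_one (by norm_num) (by norm_num)).mul_left _

lemma G_le' (n k : ℕ) : G n k ≤ 10 * (1 / 4) ^ n := by
  have := G_le n k; have := c_sq_le n k; linarith

lemma G_summable (k : ℕ) : Summable (fun n => G n k) :=
  Summable.of_nonneg_of_le (fun n => G_nonneg n k) (fun n => G_le' n k) summable_bd

lemma F_summable (k : ℕ) : Summable (fun n => F n k) :=
  Summable.of_nonneg_of_le (fun n => F_nonneg n k)
    (fun n => by have := F_le n k; have := c_sq_le n k; linarith) summable_bd

lemma sum_const (k : ℕ) : ∑' n, G n k = ∑' n, G n 0 := by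
  induction k with
  | zero => rfl
  | succ k ih =>
    rw [← ih, ← sub_eq_zero, ← (G_summable (k + 1)).tsum_sub (G_summable k)]
    simp_rw [wz]
    have hF := F_summable k
    rw [((summable_nat_add_iff 1).2 hF).tsum_sub hF, hF.tsum_eq_zero_add]
    simp [F]

open Filter Topology

lemma lim_zero : Tendsto (fun k => G 0 k) atTop (𝓝 (2 / π ^ 2)) := by
  have hW : Tendsto (fun k => ((Real.Wallis.W k)⁻¹) ^ 2) atTop (𝓝 (((π / 2)⁻¹) ^ 2)) :=
    (Real.Wallis.tendsto_W_nhds_pi_div_two.inv₀ (by positivity)).pow 2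
  have hx : Tendsto (fun k : ℕ => (1 : ℝ) / ((k : ℝ) + 1)) atTop (𝓝 0) :=
    tendsto_one_div_add_atTop_nhds_zero_nat
  have hq : Tendsto (fun k : ℕ => (2 - 3 * (1 / ((k : ℝ) + 1)) + (1 / ((k : ℝ) + 1)) ^ 2
      + (1/2) * (1 / ((k : ℝ) + 1)) ^ 3 - (3/8) * (1 / ((k : ℝ) + 1)) ^ 4
      + (1/16) * (1 / ((k : ℝ) + 1)) ^ 5) / (2 - 1 / ((k : ℝ) + 1)) ^ 2) atTop
      (𝓝 ((2 - 3 * 0 + 0 ^ 2 + (1/2) * 0 ^ 3 - (3/8) * 0 ^ 4 + (1/16) * 0 ^ 5) / (2 - 0) ^ 2)) := by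
    refine Tendsto.div ?_ ((tendsto_const_nhds.sub hx).pow 2) (by norm_num)
    exact ((((tendsto_const_nhds.sub (hx.const_mul 3)).add (hx.pow 2)).add
      ((hx.pow 3).const_mul _)).sub ((hx.pow 4).const_mul _)).add ((hx.pow 5).const_mul _)
  have h := hW.mul hq
  have e : ((π / 2)⁻¹) ^ 2 * ((2 - 3 * 0 + 0 ^ 2 + (1/2) * 0 ^ 3 - (3/8) * 0 ^ 4 + (1/16) * 0 ^ 5) / (2 - 0) ^ 2) = 2 / π ^ 2 := by
    field_simp; norm_num
  rw [e] at h
  refine h.congr fun k => ?_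
  rw [← u_wallis]
  have hk : (2 : ℝ) - 1 / ((k : ℝ) + 1) = (2 * k + 1) / (k + 1) := by field_simp; ring
  have h0 : u 0 = 1 := rfl
  rw [hk]
  simp only [G, U, p, c_zero, h0, Nat.cast_zero, mul_zero, zero_add]
  field_simp
  ring

lemma lim_succ (n : ℕ) : Tendsto (fun k => G (n + 1) k) atTop (𝓝 0) := by
  have hx : Tendsto (fun k : ℕ => (1 : ℝ) / ((k : ℝ) + 1)) atTop (𝓝 0) :=
    tendsto_one_div_add_atTop_nhds_zero_nat
  have h : Tendsto (fun k : ℕ => 10 * ((1 : ℝ) / ((k : ℝ) + 1)) ^ 2) atTop (𝓝 0) := by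
    simpa using (hx.pow 2).const_mul 10
  refine squeeze_zero (fun k => G_nonneg _ k) (fun k => (G_le (n + 1) k).trans ?_) h
  have := pow_le_pow_left₀ (c_pos (n + 1) k).le (c_le_k n k) 2
  linarith

lemma sum_G : ∑' n, G n 0 = 2 / π ^ 2 := by
  have h : Tendsto (fun k => ∑' n, G n k) atTop
      (𝓝 (∑' n : ℕ, if n = 0 then 2 / π ^ 2 else 0)) := by
    refine tendsto_tsum_of_dominated_convergence summable_bd ?_ ?_
    · intro n
      cases n with
      | zero => simpa using lim_zero
      | succ n => simpa using lim_succ n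
    · refine Eventually.of_forall fun k n => ?_
      rw [Real.norm_of_nonneg (G_nonneg n k)]
      exact G_le' n k
  simp_rw [sum_const] at h
  rw [tsum_ite_eq] at h
  exact tendsto_nhds_unique tendsto_const_nhds h

lemma poch_succ (x : ℝ) (n : ℕ) : poch x (n + 1) = poch x n * (x + n) := by
  simp [poch, Finset.prod_range_succ]

lemma poch_pos (x : ℝ) (hx : 0 < x) (n : ℕ) : 0 < poch x n := by
  unfold poch
  exact Finset.prod_pos fun i _ => by positivity

lemma coef (n : ℕ) : (1 / 16 ^ n) *
      (poch (1/2) n * poch (1/2) n * poch (3/2) n * poch (3/4) n * poch (5/4) n /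
        (poch 1 n ^ 3 * poch 2 n ^ 2)) = U n 0 * ((2 * n + 1) * (4 * n + 1) / (n + 1) ^ 2) := by
  induction n with
  | zero => simp [poch, U, u, c]
  | succ n ih =>
    have h1 := poch_pos 1 (by norm_num) n
    have h2 := poch_pos 2 (by norm_num) n
    simp only [poch_succ]
    have e : (1 / 16 ^ (n + 1)) *
      (poch (1/2) n * (1/2 + n) * (poch (1/2) n * (1/2 + n)) * (poch (3/2) n * (3/2 + n))
        * (poch (3/4) n * (3/4 + n)) * (poch (5/4) n * (5/4 + n)) /
        ((poch 1 n * (1 + n)) ^ 3 * (poch 2 n * (2 + n)) ^ 2)) =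
      ((1 / 16 ^ n) *
      (poch (1/2) n * poch (1/2) n * poch (3/2) n * poch (3/4) n * poch (5/4) n /
        (poch 1 n ^ 3 * poch 2 n ^ 2))) *
        ((1/2 + n) ^ 2 * (3/2 + n) * (3/4 + n) * (5/4 + n) /
          (16 * (1 + n) ^ 3 * (2 + n) ^ 2)) := by
      field_simp
      ring
    rw [e, ih, U_succ_left]
    push_cast
    field_simp
    ring

noncomputable def H (n : ℕ) : ℝ := U n 0 * (2048 * n ^ 3)

lemma H_summable : Summable H := by
  have hr : ‖(1 / 4 : ℝ)‖ < 1 := by rw [Real.norm_of_nonneg] <;> norm_num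
  have hs0 : Summable (fun n : ℕ => ((n:ℝ) ^ 1 * (1 / 4 : ℝ) ^ n)) :=
    summable_pow_mul_geometric_of_norm_lt_one 1 hr
  have hs : Summable (fun n : ℕ => 2048 * ((n:ℝ) ^ 1 * (1 / 4 : ℝ) ^ n)) :=
    Summable.mul_left _ hs0
  refine Summable.of_nonneg_of_le (fun n => mul_nonneg (U_nonneg n 0) (by positivity))
    (fun n => ?_) hs
  have h0 : (2048:ℝ) * n ^ 3 ≤ 2048 * n * (2 * n + 2 * (0:ℕ) + 1) ^ 2 := by
    rw [← sub_nonneg]; push_cast; ring_nf; positivity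
  have h1 := mul_le_mul_of_nonneg_left h0 (U_nonneg n 0)
  have h2 := (U_le n 0).trans (c_sq_le n 0)
  have h3 := mul_le_mul_of_nonneg_left h2 (show (0:ℝ) ≤ 2048 * n by positivity)
  unfold H
  refine h1.trans (le_trans (le_of_eq ?_) (h3.trans (le_of_eq ?_)))
  · ring
  · rw [pow_one, mul_assoc]

lemma term_eq (n : ℕ) : U n 0 * ((2 * n + 1) * (4 * n + 1) / (n + 1) ^ 2) *
    (240 * (n : ℝ) ^ 3 + 532 * (n : ℝ) ^ 2 + 336 * n + 45) =
    256 * G n 0 + (H n - H (n + 1)) := by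
  unfold G H
  rw [U_succ_left]
  unfold p
  push_cast
  field_simp
  ring

end GuilleraAux

open GuilleraAux in
theorem series_512_div_pi_sq :
    (512 : ℝ) / π ^ 2 = ∑' n : ℕ, (1 / 16 ^ n) *
      (poch (1/2) n * poch (1/2) n * poch (3/2) n * poch (3/4) n * poch (5/4) n /
        (poch 1 n ^ 3 * poch 2 n ^ 2)) *
      (240 * (n : ℝ) ^ 3 + 532 * (n : ℝ) ^ 2 + 336 * n + 45) := by
  simp_rw [coef, term_eq]
  have hH := H_summable
  have hH1 := (summable_nat_add_iff 1).2 hH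
  rw [((G_summable 0).mul_left 256).tsum_add (hH.sub hH1), tsum_mul_left, sum_G,
    hH.tsum_sub hH1, hH.tsum_eq_zero_add]
  simp [H]
  ring
end
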